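/- arXiv:2511.22917 — 14 statements merged into one kernel-verified Lean document; each statement's English description precedes it below -/
import Mathlib

section
/- Let G be an abelian group and Q a finitely generated submonoid of G that generates G as a group. Then the saturation Q^sat = {g ∈ G : ∃ n ≥ 1, n•g ∈ Q} is again a finitely generated submonoid of G. (The saturation of a fine monoid is fine.) -/
theorem stmt_3_aux_finite {G : Type*} [AddCommGroup G] [AddGroup.FG G] (S : Finset G) :
    {h : G | ∃ n : ℕ, 1 ≤ n ∧ ∃ r : G → ℕ, (∀ s, r s ≤ n) ∧ n • h = ∑ s ∈ S, r s • s}.Finite := by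
  obtain ⟨k, ι, _, p, hp, e, ⟨f⟩⟩ := AddCommGroup.equiv_free_prod_directSum_zmod G
  have : ∀ i, NeZero (p i ^ e i) := fun i => ⟨pow_ne_zero _ (hp i).ne_zero⟩
  have : Finite (DirectSum ι fun i => ZMod (p i ^ e i)) :=
    Finite.of_equiv _ (DirectSum.addEquivProd (fun i => ZMod (p i ^ e i))).symm.toEquiv
  let B : Fin k → ℤ := fun j => ∑ s ∈ S, |(f s).1 j|
  let F : G → (Fin k → ℤ) × (DirectSum ι fun i => ZMod (p i ^ e i)) :=
    fun g => (fun j => (f g).1 j, (f g).2)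
  have hF : Function.Injective F := by
    intro a b hab
    apply f.injective
    have h1 := congrArg Prod.fst hab
    have h2 := congrArg Prod.snd hab
    refine Prod.ext (Finsupp.ext fun j => congrFun h1 j) h2
  have hfin : ((Set.Icc (-B) B) ×ˢ
      (Set.univ : Set (DirectSum ι fun i => ZMod (p i ^ e i)))).Finite :=
    (Set.finite_Icc _ _).prod Set.finite_univ
  refine Set.Finite.subset (hfin.preimage hF.injOn) ?_
  rintro h ⟨n, hn, r, hr, hh⟩
  have key : ∀ j, |(f h).1 j| ≤ B j := by
    intro j
    let φ : G →+ ℤ := (Finsupp.applyAddHom j).comp ((AddMonoidHom.fst _ _).comp f.toAddMonoidHom)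
    have hφ : ∀ g, φ g = (f g).1 j := fun g => rfl
    have h1 := congrArg φ hh
    simp only [map_nsmul, map_sum, nsmul_eq_mul] at h1
    have h2 : (n : ℤ) * |φ h| ≤ n * ∑ s ∈ S, |φ s| := by
      calc (n : ℤ) * |φ h| = |(n : ℤ) * φ h| := by rw [abs_mul, Nat.abs_cast]
        _ = |∑ s ∈ S, (r s : ℤ) * φ s| := by rw [h1]
        _ ≤ ∑ s ∈ S, |(r s : ℤ) * φ s| := Finset.abs_sum_le_sum_abs _ _
        _ ≤ ∑ s ∈ S, (n : ℤ) * |φ s| := by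
          refine Finset.sum_le_sum fun s _ => ?_
          rw [abs_mul, Nat.abs_cast]
          exact mul_le_mul_of_nonneg_right (by exact_mod_cast hr s) (abs_nonneg _)
        _ = _ := by rw [Finset.mul_sum]
    exact le_of_mul_le_mul_left h2 (by exact_mod_cast hn)
  exact ⟨⟨fun j => (abs_le.1 (key j)).1, fun j => (abs_le.1 (key j)).2⟩, trivial⟩

/-- The saturation of a fine monoid is fine: if `Q` is a finitely generated
submonoid of an abelian group `G` generating `G`, then its saturation is again a
finitely generated submonoid. -/
theorem stmt_3 {G : Type*} [AddCommGroup G] (Q : AddSubmonoid G)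
    (hfg : Q.FG) (hgen : AddSubgroup.closure (Q : Set G) = ⊤) :
    ∃ Qsat : AddSubmonoid G,
      (Qsat : Set G) = {g : G | ∃ n : ℕ, 1 ≤ n ∧ n • g ∈ Q} ∧ Qsat.FG := by
  obtain ⟨S, rfl⟩ := hfg
  have : AddGroup.FG G := by
    refine ⟨⟨S, ?_⟩⟩
    rw [eq_top_iff, ← hgen, AddSubgroup.closure_le]
    exact AddSubmonoid.closure_le (S := (AddSubgroup.closure (S : Set G)).toAddSubmonoid).2
      AddSubgroup.subset_closure
  have hH := stmt_3_aux_finite S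
  let Qs : AddSubmonoid G :=
    { carrier := {g : G | ∃ n : ℕ, 1 ≤ n ∧ n • g ∈ AddSubmonoid.closure (S : Set G)}
      zero_mem' := ⟨1, le_rfl, by simp⟩
      add_mem' := by
        rintro a b ⟨n, hn, ha⟩ ⟨m, hm, hb⟩
        refine ⟨n * m, Nat.mul_pos hn hm, ?_⟩
        rw [smul_add]
        refine add_mem ?_ ?_
        · rw [mul_comm, mul_smul]; exact nsmul_mem ha m
        · rw [mul_smul]; exact nsmul_mem hb n }
  refine ⟨Qs, rfl, ?_⟩
  rw [AddSubmonoid.fg_iff]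
  refine ⟨_, le_antisymm ?_ ?_, S.finite_toSet.union hH⟩
  · rw [AddSubmonoid.closure_le]
    rintro x (hx | ⟨n, hn, r, _, hx⟩)
    · exact ⟨1, le_rfl, by simpa using AddSubmonoid.subset_closure hx⟩
    · refine ⟨n, hn, ?_⟩
      rw [hx]
      exact sum_mem fun s hs => nsmul_mem (AddSubmonoid.subset_closure hs) _
  · rintro g ⟨n, hn, hg⟩
    obtain ⟨a, -, ha⟩ := AddSubmonoid.mem_closure_finset.1 hg
    have : g = (∑ s ∈ S, (a s / n) • s) + (g - ∑ s ∈ S, (a s / n) • s) := by abel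
    rw [this]
    refine add_mem (sum_mem fun s hs => nsmul_mem ?_ _) (AddSubmonoid.subset_closure ?_)
    · exact AddSubmonoid.subset_closure (Set.mem_union_left _ hs)
    apply Set.mem_union_right
    refine ⟨n, hn, fun s => a s % n, fun s => (Nat.mod_lt _ hn).le, ?_⟩
    rw [smul_sub, ← ha, Finset.smul_sum, sub_eq_iff_eq_add, ← Finset.sum_add_distrib]
    refine Finset.sum_congr rfl fun s _ => ?_
    rw [← mul_smul, ← add_smul, Nat.mod_add_div]
end

section
/- Let P be a commutative monoid, G an abelian group, Q a submonoid of G generating G, and f, g : P → Q monoid homomorphisms. Let H be the subgroup of G generated by the set {f(p) − g(p) : p ∈ P}, let π : G → G/H be the quotient homomorphism, and let K := π(Q) be the image submonoid of G/H. Then for every cancellative commutative monoid R and every monoid homomorphism h : Q → R with h∘f = h∘g, there exists a unique monoid homomorphism h̄ : K → R such that h̄(π(q)) = h(q) for all q ∈ Q. (K, together with π restricted to Q, is the coequalizer of f and g in the category of cancellative commutative monoids.) -/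
universe u v w

/-- Coequalizers in the category of cancellative commutative monoids: given
`f, g : P → Q` with `Q` a submonoid of an abelian group `G` generating `G`,
the image `K` of `Q` in the quotient of `G` by the subgroup generated by the
differences `f p - g p` is the coequalizer of `f` and `g` among cancellative
commutative monoids. -/
theorem stmt_4 {P : Type u} [AddCommMonoid P] {G : Type v} [AddCommGroup G]
    (Q : AddSubmonoid G) (hgen : AddSubgroup.closure (Q : Set G) = ⊤)
    (f g : P →+ Q)
    (H : AddSubgroup G)
    (hH : H = AddSubgroup.closure {x : G | ∃ p : P, x = (f p : G) - (g p : G)})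
    (K : AddSubmonoid (G ⧸ H)) (hK : K = Q.map (QuotientAddGroup.mk' H))
    (R : Type w) [AddCommMonoid R] [IsCancelAdd R]
    (h : Q →+ R) (hfg : h.comp f = h.comp g) :
    ∃! hbar : K →+ R,
      ∀ (q : Q) (hq : QuotientAddGroup.mk' H (q : G) ∈ K),
        hbar ⟨QuotientAddGroup.mk' H (q : G), hq⟩ = h q := by
  subst hH
  subst hK
  have key : ∀ x ∈ AddSubgroup.closure {x : G | ∃ p : P, x = (f p : G) - (g p : G)},
      ∃ a b : Q, x = (a : G) - (b : G) ∧ h a = h b := by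
    intro x hx
    induction hx using AddSubgroup.closure_induction with
    | mem x hx =>
      obtain ⟨p, rfl⟩ := hx
      exact ⟨f p, g p, rfl, DFunLike.congr_fun hfg p⟩
    | zero => exact ⟨0, 0, by simp, rfl⟩
    | add x y _ _ hx hy =>
      obtain ⟨a, b, rfl, h1⟩ := hx
      obtain ⟨c, d, rfl, h2⟩ := hy
      refine ⟨a + c, b + d, ?_, by rw [map_add, map_add, h1, h2]⟩
      push_cast
      abel
    | neg x _ hx =>
      obtain ⟨a, b, rfl, h1⟩ := hx
      exact ⟨b, a, by abel, h1.symm⟩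
  have wd : ∀ q q' : Q, QuotientAddGroup.mk' (AddSubgroup.closure
      {x : G | ∃ p : P, x = (f p : G) - (g p : G)}) (q : G) =
      QuotientAddGroup.mk' _ (q' : G) → h q = h q' := by
    intro q q' e
    obtain ⟨a, b, e1, e2⟩ := key _ (QuotientAddGroup.eq.mp e)
    have e3 : q' + b = q + a := by
      apply Subtype.ext
      push_cast
      have : (a : G) = -(q : G) + q' + b := by rw [e1]; abel
      rw [this]; abel
    have e4 := congrArg h e3
    rw [map_add, map_add, e2] at e4
    exact (add_right_cancel e4).symm
  choose s hsQ hs using fun k : Q.map (QuotientAddGroup.mk' (AddSubgroup.closure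
      {x : G | ∃ p : P, x = (f p : G) - (g p : G)})) => AddSubmonoid.mem_map.mp k.2
  refine ⟨⟨⟨fun k => h ⟨s k, hsQ k⟩, ?_⟩, ?_⟩, ?_, ?_⟩
  · rw [← map_zero h]
    apply wd
    rw [hs]
    simp
  · intro x y
    change h _ = h _ + h _
    rw [← map_add h]
    apply wd
    rw [hs, AddSubmonoid.coe_add, AddSubmonoid.coe_add, map_add, hs, hs]
  · intro q hq
    apply wd
    rw [hs]
  · intro k hk
    ext ⟨x, q, hq, rfl⟩
    refine (hk ⟨q, hq⟩ ⟨q, hq, rfl⟩).trans ?_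
    apply wd
    rw [hs]
end

section
/- Let P, Q, Q' be finitely generated cancellative commutative monoids with P an abelian group (every element of P has an additive inverse), and let f : P → Q and f' : P → Q' be monoid homomorphisms. Then the pushout Q ⊕_P Q' of f and f' in the category of commutative additive monoids (the colimit of the span Q ← P → Q') is again a finitely generated cancellative commutative monoid. -/
universe u

/-- If `P`, `Q`, `Q'` are finitely generated cancellative commutative monoids with
`P` an abelian group, then the pushout `Q ⊕_P Q'` in the category of commutative
additive monoids (characterized here by its universal property) is again finitely
generated and cancellative. -/
theorem stmt_5 {P Q Q' : Type u} [AddCommGroup P] [AddCommMonoid Q] [AddCommMonoid Q']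
    [IsCancelAdd Q] [IsCancelAdd Q'] [AddMonoid.FG P] [AddMonoid.FG Q] [AddMonoid.FG Q']
    (f : P →+ Q) (f' : P →+ Q')
    (W : Type u) [AddCommMonoid W] (inl : Q →+ W) (inr : Q' →+ W)
    (hcomm : inl.comp f = inr.comp f')
    (huniv : ∀ (T : Type u) [AddCommMonoid T] (j : Q →+ T) (j' : Q' →+ T),
      j.comp f = j'.comp f' → ∃! k : W →+ T, k.comp inl = j ∧ k.comp inr = j') :
    IsCancelAdd W ∧ AddMonoid.FG W := by
  have hsurj : ∀ w : W, ∃ a b, w = inl a + inr b := by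
    let φ : Q × Q' →+ W := AddMonoidHom.coprod inl inr
    let S := AddMonoidHom.mrange φ
    have hl : ∀ a, inl a ∈ S := fun a => ⟨(a, 0), by simp [φ]⟩
    have hr : ∀ b, inr b ∈ S := fun b => ⟨(0, b), by simp [φ]⟩
    obtain ⟨k, ⟨hk1, hk2⟩, -⟩ := huniv S (inl.codRestrict S hl) (inr.codRestrict S hr) (by
      ext p
      exact DFunLike.congr_fun hcomm p)
    obtain ⟨k', -, hu⟩ := huniv W inl inr hcomm
    have h1 := hu (S.subtype.comp k) ⟨by
      ext a
      exact congrArg Subtype.val (DFunLike.congr_fun hk1 a), by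
      ext a
      exact congrArg Subtype.val (DFunLike.congr_fun hk2 a)⟩
    have h2 := hu (AddMonoidHom.id W) ⟨by ext; rfl, by ext; rfl⟩
    intro w
    have h3 : ((k w : S) : W) = w := DFunLike.congr_fun (h1.trans h2.symm) w
    obtain ⟨⟨a, b⟩, hab⟩ := (k w).2
    exact ⟨a, b, by rw [← h3, ← hab]; simp [φ]⟩
  have hf : ∀ p, f p + f (-p) = 0 := fun p => by rw [← map_add]; simp
  have hf' : ∀ p, f' p + f' (-p) = 0 := fun p => by rw [← map_add]; simp
  let c : AddCon (Q × Q') :=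
    { r := fun x y => ∃ p, y.1 = x.1 + f p ∧ x.2 = y.2 + f' p
      iseqv := by
        refine ⟨fun x => ⟨0, by simp⟩, ?_, ?_⟩
        · rintro x y ⟨p, h1, h2⟩
          exact ⟨-p, by rw [h1, add_assoc, hf, add_zero], by rw [h2, add_assoc, hf', add_zero]⟩
        · rintro x y z ⟨p, h1, h2⟩ ⟨q, h3, h4⟩
          refine ⟨p + q, by rw [h3, h1, map_add, add_assoc], ?_⟩
          rw [h2, h4, map_add, add_assoc, add_comm (f' p)]
      add' := by
        rintro x y z w ⟨p, h1, h2⟩ ⟨q, h3, h4⟩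
        refine ⟨p + q, ?_, ?_⟩
        · rw [Prod.fst_add, Prod.fst_add, h1, h3, map_add, add_add_add_comm]
        · rw [Prod.snd_add, Prod.snd_add, h2, h4, map_add, add_add_add_comm] }
  obtain ⟨k, ⟨hk1, hk2⟩, -⟩ := huniv c.Quotient (c.mk'.comp (AddMonoidHom.inl Q Q'))
    (c.mk'.comp (AddMonoidHom.inr Q Q')) (by
      ext p
      refine (AddCon.eq c).2 ⟨-p, ?_, ?_⟩
      · simp [hf]
      · simp [hf'])
  have hk : ∀ a b, k (inl a + inr b) = c.mk' (a, b) := by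
    intro a b
    have e1 := DFunLike.congr_fun hk1 a
    have e2 := DFunLike.congr_fun hk2 b
    simp only [AddMonoidHom.comp_apply] at e1 e2
    rw [map_add, e1, e2, ← map_add]
    simp
  have hcan : ∀ w u v : W, w + u = w + v → u = v := by
    intro w u v h
    obtain ⟨a, b, rfl⟩ := hsurj w
    obtain ⟨x, y, rfl⟩ := hsurj u
    obtain ⟨x', y', rfl⟩ := hsurj v
    have h' := congrArg k h
    rw [map_add k (inl a + inr b), map_add k (inl a + inr b), hk, hk, hk, ← map_add, ← map_add] at h'
    obtain ⟨p, h1, h2⟩ := (AddCon.eq c).1 h'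
    simp only [Prod.mk_add_mk, add_assoc] at h1 h2
    have h1 := add_left_cancel h1
    have h2 := add_left_cancel h2
    have e : inl (f p) = inr (f' p) := DFunLike.congr_fun hcomm p
    rw [h1, h2, map_add, map_add, e, add_assoc, add_comm (inr y')]
  constructor
  · have : IsLeftCancelAdd W := ⟨fun w u v h => hcan w u v h⟩
    exact AddCommMagma.IsLeftCancelAdd.toIsCancelAdd W
  · exact AddMonoid.fg_of_surjective (AddMonoidHom.coprod inl inr) (fun w => by
      obtain ⟨a, b, h⟩ := hsurj w
      exact ⟨(a, b), by simp [h]⟩)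
end

section
/- Let G be an abelian group and Q a finitely generated sharp submonoid of G that generates G. Then there exists a group homomorphism β : G → ℤ such that β(q) ≥ 0 for every q ∈ Q, and such that for q ∈ Q, β(q) = 0 implies q = 0. -/
theorem aux_base {G : Type*} [AddCommGroup G] [Module.Finite ℤ G] (s : G)
    (hs : ∀ n : ℕ, n • s = 0 → n = 0) : ∃ β : G →+ ℤ, 0 < β s := by
  have hne : (Submodule.torsion ℤ G).mkQ s ≠ 0 := by
    intro h
    rw [Submodule.mkQ_apply, Submodule.Quotient.mk_eq_zero] at h
    obtain ⟨a, ha⟩ := (Submodule.mem_torsion_iff _).1 h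
    have h0 : (a : ℤ) ≠ 0 := nonZeroDivisors.coe_ne_zero a
    have ha' : (a : ℤ) • s = 0 := ha
    have := hs (a : ℤ).natAbs (by
      rcases Int.natAbs_eq (a : ℤ) with h1 | h1
      · rw [h1, natCast_zsmul] at ha'; exact ha'
      · rw [h1, neg_smul, natCast_zsmul, neg_eq_zero] at ha'; exact ha')
    omega
  have : ∃ f : Module.Dual ℤ (G ⧸ Submodule.torsion ℤ G),
      f ((Submodule.torsion ℤ G).mkQ s) ≠ 0 := by
    by_contra! h
    exact hne ((Module.forall_dual_apply_eq_zero_iff ℤ _).1 h)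
  obtain ⟨f, hf⟩ := this
  let g : G →+ ℤ := (f.comp (Submodule.torsion ℤ G).mkQ).toAddMonoidHom
  have hg : g s ≠ 0 := hf
  rcases lt_or_gt_of_ne hg with h | h
  · exact ⟨-g, by simpa using h⟩
  · exact ⟨g, h⟩

theorem aux_main {G : Type*} [AddCommGroup G] [Module.Finite ℤ G] (n : ℕ) :
    ∀ v : Fin n → G, (∀ c : Fin n → ℕ, ∑ i, c i • v i = 0 → c = 0) →
      ∃ β : G →+ ℤ, ∀ i, 0 < β (v i) := by
  induction n with
  | zero => intro v _; exact ⟨0, fun i => i.elim0⟩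
  | succ n ih =>
    intro v hv
    rcases Nat.eq_zero_or_pos n with rfl | hn
    · obtain ⟨β, hβ⟩ := aux_base (v 0) (by
        intro m hm
        have := hv (fun _ => m) (by simpa using hm)
        simpa using congrFun this 0)
      exact ⟨β, fun i => by rw [Fin.eq_zero i]; exact hβ⟩
    obtain ⟨β, hβ⟩ := ih (fun i => v i.succ) (by
      intro c hc
      have := hv (Fin.cons 0 c) (by simpa [Fin.sum_univ_succ] using hc)
      funext i
      simpa using congrFun this i.succ)
    rcases lt_or_ge 0 (β (v 0)) with hb | hb
    · exact ⟨β, fun i => Fin.cases hb hβ i⟩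
    obtain ⟨b, hbb⟩ : ∃ b : ℕ, β (v 0) = -(b : ℤ) := ⟨(-β (v 0)).toNat, by omega⟩
    have : ∀ i : Fin n, ∃ p : ℕ, β (v i.succ) = p := fun i =>
      ⟨(β (v i.succ)).toNat, by have := hβ i; omega⟩
    choose p hp using this
    have hp0 : ∀ i, 0 < p i := fun i => by have := hβ i; have := hp i; omega
    obtain ⟨γ, hγ⟩ := ih (fun i => b • v i.succ + p i • v 0) (by
      intro d hd
      have := hv (Fin.cons (∑ i, d i * p i) (fun i => d i * b)) (by
        rw [Fin.sum_univ_succ, ← hd]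
        simp only [Fin.cons_zero, Fin.cons_succ, smul_add, Finset.sum_add_distrib,
          Finset.sum_smul, mul_smul]
        abel)
      have h0 : ∑ i, d i * p i = 0 := by simpa using congrFun this 0
      rw [Finset.sum_eq_zero_iff] at h0
      funext i
      have := h0 i (Finset.mem_univ i)
      have h2 := hp0 i
      rcases Nat.mul_eq_zero.1 this with h | h
      · exact h
      · omega)
    have hγ' : ∀ i, 0 < (b : ℚ) * γ (v i.succ) + p i * γ (v 0) := fun i => by
      have := hγ i
      simp only [map_add, map_nsmul, nsmul_eq_mul] at this
      exact_mod_cast this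
    have hpq : ∀ i, (0 : ℚ) < p i := fun i => by exact_mod_cast hp0 i
    obtain ⟨k, hk1, hk2⟩ : ∃ k : ℚ, (∀ i, 0 < (γ (v i.succ) : ℚ) + k * p i) ∧
        0 < (γ (v 0) : ℚ) - k * b := by
      obtain ⟨k, hk1, hk2⟩ := Order.exists_between_finsets
        (Finset.univ.image fun i => -(γ (v (Fin.succ i)) : ℚ) / p i)
        (if b = 0 then ∅ else {(γ (v 0) : ℚ) / b}) (by
          intro x hx y hy
          split_ifs at hy with h
          · simp at hy
          · have hb0 : (0 : ℚ) < b := by exact_mod_cast Nat.pos_of_ne_zero h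
            simp only [Finset.mem_image, Finset.mem_univ, true_and] at hx
            obtain ⟨i, rfl⟩ := hx
            rw [Finset.mem_singleton.1 hy, div_lt_div_iff₀ (hpq i) hb0]
            linarith [hγ' i])
      refine ⟨k, fun i => ?_, ?_⟩
      · have := hk1 _ (Finset.mem_image_of_mem _ (Finset.mem_univ i))
        rw [div_lt_iff₀ (hpq i)] at this
        linarith
      · by_cases h : b = 0
        · have := hγ' ⟨0, hn⟩
          subst h
          simp only [Nat.cast_zero, zero_mul, zero_add] at this
          simpa using pos_of_mul_pos_right this (hpq _).le
        · have hb0 : (0 : ℚ) < b := by exact_mod_cast Nat.pos_of_ne_zero h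
          have := hk2 (γ (v 0) / b) (by simp [h])
          rw [lt_div_iff₀ hb0] at this
          linarith
    have hd : (0 : ℚ) < k.den := by exact_mod_cast k.den_pos
    have hkd : k * k.den = k.num := Rat.mul_den_eq_num k
    refine ⟨k.den • γ + k.num • β, fun i => Fin.cases ?_ (fun i => ?_) i⟩
    · simp only [AddMonoidHom.add_apply, AddMonoidHom.nsmul_apply, AddMonoidHom.zsmul_apply,
        hbb, nsmul_eq_mul, smul_eq_mul]
      have := mul_pos hd hk2
      have h : (0 : ℚ) < k.den * γ (v 0) + k.num * (-b) := by rw [← hkd]; linarith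
      exact_mod_cast h
    · simp only [AddMonoidHom.add_apply, AddMonoidHom.nsmul_apply, AddMonoidHom.zsmul_apply,
        hp, nsmul_eq_mul, smul_eq_mul]
      have := mul_pos hd (hk1 i)
      have h : (0 : ℚ) < k.den * γ (v i.succ) + k.num * p i := by rw [← hkd]; linarith
      exact_mod_cast h

/-- For a finitely generated sharp submonoid `Q` of an abelian group `G` generating
`G`, there is a group homomorphism `β : G → ℤ` which is nonnegative on `Q` and whose
vanishing locus in `Q` is `{0}`. -/
theorem stmt_6 {G : Type*} [AddCommGroup G] (Q : AddSubmonoid G) (hfg : Q.FG)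
    (hsharp : ∀ q ∈ Q, -q ∈ Q → q = 0)
    (hgen : AddSubgroup.closure (Q : Set G) = ⊤) :
    ∃ β : G →+ ℤ, (∀ q ∈ Q, 0 ≤ β q) ∧ ∀ q ∈ Q, β q = 0 → q = 0 := by
  classical
  obtain ⟨S, hS⟩ := hfg
  have hfin : Module.Finite ℤ G := by
    rw [Module.Finite.iff_addGroup_fg]
    refine ⟨⟨S, ?_⟩⟩
    rw [eq_top_iff, ← hgen, AddSubgroup.closure_le, ← hS]
    have : AddSubmonoid.closure (S : Set G) ≤
        (AddSubgroup.closure (S : Set G)).toAddSubmonoid :=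
      AddSubmonoid.closure_le.2 AddSubgroup.subset_closure
    exact this
  let e := (S.erase 0).equivFin.symm
  have hmem : ∀ i, (e i : G) ∈ Q := fun i => by
    rw [← hS]
    exact AddSubmonoid.subset_closure (Finset.mem_of_mem_erase (e i).2)
  obtain ⟨β, hβ⟩ := aux_main _ (fun i => (e i : G)) (by
    intro c hc
    funext j
    by_contra hj
    have hj : c j ≠ 0 := hj
    obtain ⟨m, hm⟩ := Nat.exists_eq_succ_of_ne_zero hj
    rw [← Finset.add_sum_erase _ _ (Finset.mem_univ j), hm, Nat.succ_eq_add_one, succ_nsmul'] at hc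
    rw [add_assoc] at hc
    refine Finset.ne_of_mem_erase (e j).2 (hsharp _ (hmem j) ?_)
    rw [neg_eq_of_add_eq_zero_right hc]
    exact Q.add_mem (Q.nsmul_mem (hmem j) _)
      (Q.sum_mem fun i _ => Q.nsmul_mem (hmem i) _))
  have key : ∀ q ∈ Q, q = 0 ∨ 0 < β q := by
    intro q hq
    rw [← hS] at hq
    induction hq using AddSubmonoid.closure_induction with
    | mem x hx =>
      by_cases h : x = 0
      · exact Or.inl h
      · right
        simpa using hβ (e.symm ⟨x, Finset.mem_erase.2 ⟨h, hx⟩⟩)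
    | zero => exact Or.inl rfl
    | add x y _ _ hx hy =>
      rcases hx with rfl | hx
      · simpa using hy
      · rcases hy with rfl | hy
        · right; simpa using hx
        · right; rw [map_add]; exact add_pos hx hy
  refine ⟨β, fun q hq => ?_, fun q hq h0 => ?_⟩
  · rcases key q hq with rfl | h
    · simp
    · exact h.le
  · rcases key q hq with h | h
    · exact h
    · omega
end

section
/- Let G be a finitely generated abelian group and Q a finitely generated submonoid of G generating G. Consider the dual monoid Q^∨ := {φ ∈ Hom(G, ℤ) : φ(q) ≥ 0 for all q ∈ Q}, a submonoid of the abelian group Hom(G, ℤ) of group homomorphisms under pointwise addition. Then Q^∨ is finitely generated as a monoid, sharp, and saturated as a submonoid of Hom(G, ℤ). -/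
/-- The dual of a fine monoid is fine, sharp and saturated: for a finitely generated
submonoid `Q` of a finitely generated abelian group `G` generating `G`, the dual
monoid `Q^∨ = {φ : G →+ ℤ | φ ≥ 0 on Q}` is finitely generated, sharp, and saturated
as a submonoid of `Hom(G, ℤ)`. -/
theorem stmt_7 {G : Type*} [AddCommGroup G] [AddGroup.FG G]
    (Q : AddSubmonoid G) (hfg : Q.FG)
    (hgen : AddSubgroup.closure (Q : Set G) = ⊤)
    (Qdual : AddSubmonoid (G →+ ℤ))
    (hdual : ∀ φ : G →+ ℤ, φ ∈ Qdual ↔ ∀ q ∈ Q, 0 ≤ φ q) :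
    Qdual.FG ∧ (∀ φ ∈ Qdual, -φ ∈ Qdual → φ = 0) ∧
    ∀ (φ : G →+ ℤ) (n : ℕ), 1 ≤ n → n • φ ∈ Qdual → φ ∈ Qdual := by
  have hext : ∀ φ ψ : G →+ ℤ, (∀ q ∈ Q, φ q = ψ q) → φ = ψ := by
    intro φ ψ h
    exact AddMonoidHom.eq_of_eqOn_dense hgen (fun q hq => h q hq)
  refine ⟨?_, ?_, ?_⟩
  · obtain ⟨S, hS⟩ := hfg
    have hS' : ∀ φ : G →+ ℤ, (∀ s : S, 0 ≤ φ s) → φ ∈ Qdual := by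
      intro φ h
      rw [hdual]
      intro q hq
      rw [← hS] at hq
      induction hq using AddSubmonoid.closure_induction with
      | mem x hx => exact h ⟨x, hx⟩
      | zero => simp
      | add x y _ _ hx hy => rw [map_add]; exact add_nonneg hx hy
    have hSQ : ∀ s : S, (s : G) ∈ Q := by
      intro s
      rw [← hS]
      exact AddSubmonoid.subset_closure s.2
    let F : (G →+ ℤ) →+ (S → ℤ) :=
      { toFun := fun φ s => φ s
        map_zero' := by ext; simp
        map_add' := by intros; ext; simp }
    have hF : Function.Injective F := by
      intro φ ψ h
      apply hext
      intro q hq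
      rw [← hS] at hq
      exact AddMonoidHom.eqOn_closureM (f := φ) (g := ψ)
        (fun s hs => congrFun h ⟨s, hs⟩) hq
    let C : (S → ℕ) →+ (S → ℤ) :=
      { toFun := fun y s => (y s : ℤ)
        map_zero' := by ext; simp
        map_add' := by intros; ext; simp }
    let P : AddSubmonoid (S → ℕ) := (AddMonoidHom.mrange F).comap C
    have hP : P.FG := by
      apply AddSubmonoid.fg_of_subtractive
      rintro x ⟨φ, hφ⟩ y ⟨ψ, hψ⟩
      refine ⟨ψ - φ, ?_⟩
      rw [map_sub, hφ, hψ, map_add, add_sub_cancel_left]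
    have hmap : Qdual.map F = P.map C := by
      ext z
      constructor
      · rintro ⟨φ, hφ, rfl⟩
        have hC : C (fun s => (φ s).toNat) = F φ := by
          ext s
          exact Int.toNat_of_nonneg ((hdual φ).1 hφ s (hSQ s))
        exact ⟨_, ⟨φ, hC.symm⟩, hC⟩
      · rintro ⟨y, ⟨φ, hφ⟩, rfl⟩
        refine ⟨φ, hS' φ fun s => ?_, hφ⟩
        have := congrFun hφ s
        change φ s = (y s : ℤ) at this
        omega
    have := hP.map C
    rw [← hmap] at this
    exact AddSubmonoid.FG.map_injective F hF this
  · intro φ h1 h2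
    apply hext
    intro q hq
    have a := (hdual _).1 h1 q hq
    have b := (hdual _).1 h2 q hq
    simp at b ⊢
    omega
  · intro φ n hn h
    rw [hdual] at h ⊢
    intro q hq
    have := h q hq
    simp only [AddMonoidHom.nsmul_apply, nsmul_eq_mul] at this
    exact nonneg_of_mul_nonneg_right this (by exact_mod_cast hn)
end

section
/- Let G be an abelian group and Q a finitely generated sharp submonoid of G generating G. Let Q^∨ := {φ ∈ Hom(G, ℤ) : φ(q) ≥ 0 for all q ∈ Q} with pointwise addition. Then: (a) for every s ∈ Q^sat and every φ ∈ Q^∨ one has φ(s) ≥ 0; (b) the resulting evaluation map ev : Q^sat → Hom_{Mon}(Q^∨, ℕ), ev(s)(φ) = φ(s), is a monoid homomorphism which is surjective onto the monoid of all monoid homomorphisms from Q^∨ to ℕ; and (c) ev(s) = ev(s') if and only if s − s' is a torsion element of G. (Thus the natural map Q → Q^∨∨ induces an isomorphism from the sharpening of Q^sat onto the double dual Q^∨∨.) -/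
theorem aux_farkas {H : Type*} [AddCommGroup H] (k : ℕ) : ∀ (l : List (H →+ ℤ)) (_ : l.length = k)
    (b : H →+ ℤ) (_ : ∀ x, (∀ a ∈ l, 0 ≤ a x) → 0 ≤ b x),
    ∃ n : ℕ, 1 ≤ n ∧ n • b ∈ AddSubmonoid.closure {a | a ∈ l} := by
  induction k with
  | zero =>
    intro l hl b hb
    obtain rfl := List.length_eq_zero_iff.mp hl
    refine ⟨1, le_rfl, ?_⟩
    have : b = 0 := by
      ext x
      have h1 := hb x (by simp)
      have h2 := hb (-x) (by simp)
      rw [map_neg] at h2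
      simp only [AddMonoidHom.zero_apply]
      omega
    rw [this, smul_zero]
    exact zero_mem _
  | succ k ih =>
    intro l hl b hb
    obtain ⟨a0, l, rfl⟩ := List.exists_cons_of_length_eq_add_one hl
    have hl : l.length = k := by simpa using hl
    by_cases h : ∀ x, (∀ a ∈ l, 0 ≤ a x) → 0 ≤ b x
    · obtain ⟨n, hn, hm⟩ := ih l hl b h
      refine ⟨n, hn, AddSubmonoid.closure_mono ?_ hm⟩
      intro a ha
      exact List.mem_cons_of_mem _ ha
    · push Not at h
      obtain ⟨x, hx, hbx⟩ := h
      have ha0 : a0 x < 0 := by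
        by_contra hc
        push Not at hc
        have := hb x (by
          intro a ha
          rcases List.mem_cons.mp ha with rfl | ha
          · exact hc
          · exact hx a ha)
        omega
      obtain ⟨N, hN⟩ := Int.eq_ofNat_of_zero_le (a := - a0 x) (by omega)
      obtain ⟨B, hB⟩ := Int.eq_ofNat_of_zero_le (a := - b x) (by omega)
      obtain ⟨n, hn, hm⟩ := ih (l.map fun a => N • a + (a x) • a0) (by simpa using hl)
        (N • b + (b x) • a0) (by
          intro y hy
          have key : ∀ a : H →+ ℤ, (N • a + (a x) • a0) y = a (N • y + (a0 y) • x) := by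
            intro a
            simp only [AddMonoidHom.add_apply, AddMonoidHom.smul_apply, map_add, map_nsmul,
              map_zsmul, smul_eq_mul]
            ring
          rw [key]
          apply hb
          intro a ha
          rcases List.mem_cons.mp ha with rfl | ha
          · simp only [map_add, map_nsmul, map_zsmul, smul_eq_mul, nsmul_eq_mul]
            rw [← hN]
            apply le_of_eq
            ring
          · rw [← key]
            exact hy _ (List.mem_map_of_mem ha))
      set C := AddSubmonoid.closure {a | a ∈ a0 :: l} with hC
      have hm0 : a0 ∈ C := AddSubmonoid.subset_closure (by simp)
      have hsub : n • (N • b + (b x) • a0) ∈ C := by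
        refine (AddSubmonoid.closure_le (S := C)).mpr ?_ hm
        intro c hc
        obtain ⟨a, ha, rfl⟩ := List.mem_map.mp hc
        obtain ⟨A, hA⟩ := Int.eq_ofNat_of_zero_le (hx a ha)
        have haC : a ∈ C := AddSubmonoid.subset_closure (List.mem_cons_of_mem _ ha)
        simp only [hA, natCast_zsmul]
        exact add_mem (nsmul_mem haC _) (nsmul_mem hm0 _)
      refine ⟨n * N, Nat.mul_pos hn (by omega), ?_⟩
      have : (n * N) • b = n • (N • b + (b x) • a0) + (n * B) • a0 := by
        ext y
        have : b x = -(B : ℤ) := by omega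
        simp only [AddMonoidHom.add_apply, AddMonoidHom.smul_apply, smul_eq_mul, nsmul_eq_mul, this]
        push_cast
        ring
      rw [this]
      exact add_mem hsub (nsmul_mem hm0 _)

theorem aux_tors {G : Type*} [AddCommGroup G] [Module.Finite ℤ G] (g : G)
    (h : ∀ φ : G →+ ℤ, φ g = 0) : ∃ n : ℕ, 1 ≤ n ∧ n • g = 0 := by
  let T := Submodule.torsion ℤ G
  have h0 : T.mkQ g = 0 := by
    apply (Module.bijective_dual_eval ℤ (G ⧸ T)).1
    ext φ
    simpa using h (φ.comp T.mkQ).toAddMonoidHom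
  rw [Submodule.mkQ_apply, Submodule.Quotient.mk_eq_zero] at h0
  obtain ⟨⟨a, ha⟩, hag⟩ := (Submodule.mem_torsion_iff g).mp h0
  have ha : a ≠ 0 := nonZeroDivisors.ne_zero ha
  refine ⟨a.natAbs, by omega, ?_⟩
  have hag : a • g = 0 := hag
  rcases Int.natAbs_eq a with h | h
  · rw [h, natCast_zsmul] at hag
    exact hag
  · rw [h, neg_smul, natCast_zsmul, neg_eq_zero] at hag
    exact hag

theorem aux_refl {G : Type*} [AddCommGroup G] [Module.Finite ℤ G] (E : (G →+ ℤ) →+ ℤ) :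
    ∃ g : G, ∀ φ : G →+ ℤ, E φ = φ g := by
  let T := Submodule.torsion ℤ G
  let E' : Module.Dual ℤ (Module.Dual ℤ (G ⧸ T)) :=
    (AddMonoidHom.mk' (fun φ : Module.Dual ℤ (G ⧸ T) => E (φ.comp T.mkQ).toAddMonoidHom) (by
      intro a b
      rw [← map_add]
      rfl)).toIntLinearMap
  obtain ⟨y, hy⟩ := (Module.bijective_dual_eval ℤ (G ⧸ T)).2 E'
  obtain ⟨g, rfl⟩ := T.mkQ_surjective y
  refine ⟨g, fun φ => ?_⟩
  have hT : T ≤ LinearMap.ker φ.toIntLinearMap := by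
    intro t ht
    obtain ⟨⟨a, ha⟩, hag⟩ := (Submodule.mem_torsion_iff t).mp ht
    have ha : a ≠ 0 := nonZeroDivisors.ne_zero ha
    have hag : a • t = 0 := hag
    have := congrArg φ hag
    rw [map_zsmul, map_zero, smul_eq_mul] at this
    rw [LinearMap.mem_ker]
    exact (mul_eq_zero.mp this).resolve_left ha
  have h1 := LinearMap.congr_fun hy (T.liftQ φ.toIntLinearMap hT)
  have h2 : ((T.liftQ φ.toIntLinearMap hT).comp T.mkQ).toAddMonoidHom = φ := by
    ext x
    simp
  have h3 : E' (T.liftQ φ.toIntLinearMap hT) = E φ := by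
    change E _ = _
    rw [h2]
  rw [← h3, ← h1]
  simp

/-- The natural map from the saturation `Q^sat` to the double dual `Q^∨∨`:
(a) dual functionals are nonnegative on the saturation; (b) the evaluation monoid
homomorphism `ev : Q^sat →+ Hom(Q^∨, ℕ)` is surjective; (c) two elements of `Q^sat`
have the same image under `ev` iff their difference is torsion. -/
theorem stmt_9 {G : Type*} [AddCommGroup G] (Q : AddSubmonoid G) (hfg : Q.FG)
    (hsharp : ∀ q ∈ Q, -q ∈ Q → q = 0)
    (hgen : AddSubgroup.closure (Q : Set G) = ⊤)
    (Qsat : AddSubmonoid G)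
    (hQsat : ∀ g : G, g ∈ Qsat ↔ ∃ n : ℕ, 1 ≤ n ∧ n • g ∈ Q)
    (Qdual : AddSubmonoid (G →+ ℤ))
    (hdual : ∀ φ : G →+ ℤ, φ ∈ Qdual ↔ ∀ q ∈ Q, 0 ≤ φ q) :
    (∀ s ∈ Qsat, ∀ φ ∈ Qdual, 0 ≤ φ s) ∧
    ∃ ev : Qsat →+ (Qdual →+ ℕ),
      (∀ (s : Qsat) (φ : Qdual), ((ev s φ : ℕ) : ℤ) = (φ : G →+ ℤ) (s : G)) ∧
      Function.Surjective ev ∧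
      ∀ s s' : Qsat, ev s = ev s' ↔ ∃ n : ℕ, 1 ≤ n ∧ n • ((s : G) - (s' : G)) = 0 := by
  classical
  obtain ⟨S, hS⟩ := hfg
  have hSQ : ∀ q ∈ S, q ∈ Q := fun q hq => hS ▸ AddSubmonoid.subset_closure hq
  have hfin : Module.Finite ℤ G := by
    rw [Module.Finite.iff_addGroup_fg]
    refine ⟨⟨S, ?_⟩⟩
    rw [eq_top_iff, ← hgen, AddSubgroup.closure_le, ← hS]
    exact (AddSubmonoid.closure_le (S := (AddSubgroup.closure (S : Set G)).toAddSubmonoid)).mpr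
      AddSubgroup.subset_closure
  have hdualS : ∀ φ : G →+ ℤ, (∀ q ∈ S, 0 ≤ φ q) → φ ∈ Qdual := by
    intro φ h
    rw [hdual, ← hS]
    intro q hq
    induction hq using AddSubmonoid.closure_induction with
    | mem x hx => exact h x hx
    | zero => simp
    | add x y _ _ hx hy => rw [map_add]; exact add_nonneg hx hy
  have ha : ∀ s ∈ Qsat, ∀ φ ∈ Qdual, 0 ≤ φ s := by
    intro s hs φ hφ
    obtain ⟨n, hn, hq⟩ := (hQsat s).mp hs
    have := (hdual φ).mp hφ _ hq
    rw [map_nsmul, nsmul_eq_mul] at this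
    exact nonneg_of_mul_nonneg_right this (by exact_mod_cast hn)
  -- Farkas
  have hfarkas : ∀ g : G, (∀ φ ∈ Qdual, 0 ≤ φ g) → g ∈ Qsat := by
    intro g hg
    let e : G →+ ((G →+ ℤ) →+ ℤ) := AddMonoidHom.flip (AddMonoidHom.id (G →+ ℤ))
    have he : ∀ x φ, e x φ = φ x := fun _ _ => rfl
    obtain ⟨n, hn, hm⟩ := aux_farkas _ (S.toList.map e) rfl (e g) (by
      intro φ hφ
      apply hg
      apply hdualS
      intro q hq
      exact hφ (e q) (List.mem_map_of_mem (by simpa using hq)))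
    have : AddSubmonoid.closure {a | a ∈ S.toList.map e} ≤ Q.map e := by
      rw [AddSubmonoid.closure_le]
      intro c hc
      obtain ⟨q, hq, rfl⟩ := List.mem_map.mp hc
      exact ⟨q, hSQ q (by simpa using hq), rfl⟩
    obtain ⟨q, hq, hqe⟩ := this hm
    obtain ⟨m, hm1, hm2⟩ := aux_tors (n • g - q) (by
      intro φ
      have := DFunLike.congr_fun hqe φ
      rw [← map_nsmul, he, he] at this
      rw [map_sub, this, sub_self])
    rw [hQsat]
    refine ⟨m * n, Nat.mul_pos hm1 hn, ?_⟩
    rw [smul_sub, sub_eq_zero] at hm2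
    rw [mul_smul, hm2]
    exact nsmul_mem hq m
  have hpos : ∀ q ∈ S, ∃ φ ∈ Qdual, q ≠ 0 → 1 ≤ φ q := by
    intro q hq
    by_contra hc
    push Not at hc
    have h0 := (hc 0 (zero_mem _)).1
    have : -q ∈ Qsat := by
      apply hfarkas
      intro φ hφ
      have := (hc φ hφ).2
      rw [map_neg]
      omega
    obtain ⟨n, hn, hnq⟩ := (hQsat _).mp this
    apply h0
    apply hsharp q (hSQ q hq)
    obtain ⟨m, rfl⟩ : ∃ m, n = m + 1 := ⟨n - 1, by omega⟩
    have h := add_mem hnq (nsmul_mem (hSQ q hq) m)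
    convert h using 1
    rw [smul_neg, add_smul, one_smul]
    abel
  choose! p hp1 hp2 using hpos
  have hbig : ∀ ψ : G →+ ℤ, ∃ a b : Qdual, ψ = (a : G →+ ℤ) - b := by
    intro ψ
    have hM : ∑ q ∈ S, (ψ q).natAbs • p q ∈ Qdual :=
      sum_mem fun q hq => nsmul_mem (hp1 q hq) _
    refine ⟨⟨ψ + ∑ q ∈ S, (ψ q).natAbs • p q, ?_⟩, ⟨_, hM⟩, by simp⟩
    apply hdualS
    intro q hq
    by_cases hq0 : q = 0
    · simp [hq0]
    have h1 : (ψ q).natAbs • p q q ≤ ∑ r ∈ S, (ψ r).natAbs • p r q :=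
      Finset.single_le_sum (f := fun r => (ψ r).natAbs • p r q)
        (fun r hr => nsmul_nonneg ((hdual _).mp (hp1 r hr) q (hSQ q hq)) _) hq
    have h2 := hp2 q hq hq0
    rw [AddMonoidHom.add_apply, AddMonoidHom.finsetSum_apply]
    simp only [AddMonoidHom.smul_apply]
    rw [nsmul_eq_mul] at h1
    have h3 : ((ψ q).natAbs : ℤ) * 1 ≤ (ψ q).natAbs * p q q :=
      mul_le_mul_of_nonneg_left h2 (by positivity)
    omega
  refine ⟨ha, ?_⟩
  have hc : ∀ (s : Qsat) (φ : Qdual),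
      (((φ : G →+ ℤ) (s : G)).toNat : ℤ) = (φ : G →+ ℤ) (s : G) :=
    fun s φ => Int.toNat_of_nonneg (ha s s.2 φ φ.2)
  let ev : Qsat →+ (Qdual →+ ℕ) :=
    { toFun := fun s =>
        { toFun := fun φ => ((φ : G →+ ℤ) (s : G)).toNat
          map_zero' := by simp
          map_add' := by
            intro φ ψ
            exact Int.toNat_add (ha s s.2 φ φ.2) (ha s s.2 ψ ψ.2) }
      map_zero' := by
        ext φ
        simp
      map_add' := by
        intro s t
        ext φ
        simp only [AddMonoidHom.coe_mk, ZeroHom.coe_mk, AddMonoidHom.add_apply]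
        rw [AddSubmonoid.coe_add, map_add]
        exact Int.toNat_add (ha s s.2 φ φ.2) (ha t t.2 φ φ.2) }
  have hev : ∀ (s : Qsat) (φ : Qdual), ((ev s φ : ℕ) : ℤ) = (φ : G →+ ℤ) (s : G) := hc
  refine ⟨ev, hev, ?_, ?_⟩
  · intro f
    choose a b hab using hbig
    have key : ∀ c d c' d' : Qdual, (c : G →+ ℤ) - d = (c' : G →+ ℤ) - d' →
        (f c : ℤ) - f d = f c' - f d' := by
      intro c d c' d' h
      have h1 : c + d' = c' + d := by
        apply Subtype.ext
        push_cast
        exact sub_eq_sub_iff_add_eq_add.mp h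
      have h2 := congrArg f h1
      rw [map_add, map_add] at h2
      omega
    let E : (G →+ ℤ) →+ ℤ := AddMonoidHom.mk' (fun ψ => (f (a ψ) : ℤ) - f (b ψ)) (by
      intro x y
      have h := key (a (x + y)) (b (x + y)) (a x + a y) (b x + b y) (by
        rw [← hab]
        push_cast
        rw [add_sub_add_comm, ← hab, ← hab])
      rw [h, map_add, map_add]
      push_cast
      ring)
    obtain ⟨g, hg⟩ := aux_refl E
    have hE : ∀ φ : Qdual, (f φ : ℤ) = (φ : G →+ ℤ) g := by
      intro φ
      rw [← hg]
      have h := key (a φ) (b φ) φ 0 (by rw [← hab]; simp)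
      change _ = (f (a φ) : ℤ) - f (b φ)
      rw [h]
      simp
    refine ⟨⟨g, hfarkas g ?_⟩, ?_⟩
    · intro φ hφ
      rw [← hE ⟨φ, hφ⟩]
      positivity
    · ext φ
      have h1 := hev ⟨g, hfarkas g (fun φ hφ => by rw [← hE ⟨φ, hφ⟩]; positivity)⟩ φ
      have h2 := hE φ
      exact_mod_cast h1.trans h2.symm
  · intro s s'
    constructor
    · intro h
      apply aux_tors
      have h1 : ∀ φ : Qdual, (φ : G →+ ℤ) ((s : G) - s') = 0 := by
        intro φ
        rw [map_sub, ← hev, ← hev, h, sub_self]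
      intro ψ
      obtain ⟨a, b, rfl⟩ := hbig ψ
      rw [AddMonoidHom.sub_apply, h1, h1, sub_self]
    · rintro ⟨n, hn, h⟩
      ext φ
      have h1 := congrArg (φ : G →+ ℤ) h
      rw [map_nsmul, map_zero, map_sub, ← hev, ← hev, nsmul_eq_mul] at h1
      have h2 := (mul_eq_zero.mp h1).resolve_left (by exact_mod_cast (by omega : n ≠ 0))
      omega
end

section
/- Let G be an abelian group and Q a submonoid generating G, and let q₁, …, qₘ ∈ Q be a finite generating set of the monoid Q. Then the ℂ-algebra homomorphism ℂ[Q] → ℂ[G] induced by the inclusion Q ↪ G (sending χ^q to χ^q) is injective, and it exhibits ℂ[G] as the localization of ℂ[Q] away from the single element χ^{q₁+⋯+qₘ} (i.e., ℂ[G], as a ℂ[Q]-algebra via this map, satisfies the universal property of inverting χ^{q₁+⋯+qₘ}). In particular T_Q = Spec ℂ[G] is a dense open subscheme of V_Q = Spec ℂ[Q]. -/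
universe u v

theorem aux_exists {G : Type u} [AddCommGroup G] (Q : AddSubmonoid G)
    (hgen : AddSubgroup.closure (Q : Set G) = ⊤)
    (m : ℕ) (q : Fin m → Q)
    (hq : AddSubmonoid.closure (Set.range fun i => (q i : G)) = Q) (g : G) :
    ∃ n : ℕ, g + n • ((∑ i, q i : Q) : G) ∈ Q := by
  set s : G := ((∑ i, q i : Q) : G) with hs
  have hsQ : s ∈ Q := (∑ i, q i : Q).2
  have h1 : ∀ x ∈ Q, ∃ n : ℕ, -x + n • s ∈ Q := by
    intro x hx
    rw [← hq] at hx
    induction hx using AddSubmonoid.closure_induction with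
    | mem x hx =>
      obtain ⟨i, rfl⟩ := hx
      refine ⟨1, ?_⟩
      have : s = (q i : G) + ((∑ j ∈ Finset.univ.erase i, q j : Q) : G) := by
        rw [hs, ← Finset.add_sum_erase _ _ (Finset.mem_univ i)]; rfl
      rw [one_smul, this, neg_add_cancel_left]
      exact Subtype.property _
    | zero => exact ⟨0, by simp⟩
    | add x y _ _ hx hy =>
      obtain ⟨a, ha⟩ := hx
      obtain ⟨b, hb⟩ := hy
      refine ⟨a + b, ?_⟩
      have := Q.add_mem ha hb
      convert this using 1
      rw [add_smul]; abel
  have h2 : (∃ n : ℕ, g + n • s ∈ Q) ∧ (∃ n : ℕ, -g + n • s ∈ Q) := by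
    have hg : g ∈ AddSubgroup.closure (Q : Set G) := by rw [hgen]; trivial
    induction hg using AddSubgroup.closure_induction with
    | mem x hx => exact ⟨⟨0, by simpa using hx⟩, h1 x hx⟩
    | zero => exact ⟨⟨0, by simp⟩, ⟨0, by simp⟩⟩
    | add x y _ _ hx hy =>
      obtain ⟨⟨a, ha⟩, ⟨b, hb⟩⟩ := hx
      obtain ⟨⟨c, hc⟩, ⟨d, hd⟩⟩ := hy
      refine ⟨⟨a + c, ?_⟩, ⟨b + d, ?_⟩⟩
      · convert Q.add_mem ha hc using 1
        rw [add_smul]; abel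
      · convert Q.add_mem hb hd using 1
        rw [add_smul]; abel
    | neg x _ hx => exact ⟨hx.2, by simpa using hx.1⟩
  exact h2.1

/-- For a submonoid `Q` of an abelian group `G` generating `G`, with a finite
generating family `q₁, …, qₘ` of `Q`, the induced map `ℂ[Q] → ℂ[G]` of monoid
algebras is injective, and `ℂ[G]` satisfies the universal property of the
localization of `ℂ[Q]` away from `χ^{q₁ + ⋯ + qₘ}`. -/
theorem stmt_10 {G : Type u} [AddCommGroup G] (Q : AddSubmonoid G)
    (hgen : AddSubgroup.closure (Q : Set G) = ⊤)
    (m : ℕ) (q : Fin m → Q)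
    (hq : AddSubmonoid.closure (Set.range fun i => (q i : G)) = Q) :
    Function.Injective (AddMonoidAlgebra.mapDomainRingHom ℂ Q.subtype) ∧
    IsUnit (AddMonoidAlgebra.mapDomainRingHom ℂ Q.subtype
      (AddMonoidAlgebra.single (∑ i, q i) (1 : ℂ))) ∧
    ∀ (B : Type v) [CommRing B] (ψ : AddMonoidAlgebra ℂ Q →+* B),
      IsUnit (ψ (AddMonoidAlgebra.single (∑ i, q i) (1 : ℂ))) →
      ∃! ψ' : AddMonoidAlgebra ℂ G →+* B,
        ψ'.comp (AddMonoidAlgebra.mapDomainRingHom ℂ Q.subtype) = ψ := by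
  set φ := AddMonoidAlgebra.mapDomainRingHom ℂ Q.subtype with hφ
  have hφs : ∀ (x : Q) (r : ℂ), φ (AddMonoidAlgebra.single x r) =
      AddMonoidAlgebra.single (x : G) r := by
    intro x r
    simp [hφ, AddMonoidAlgebra.mapDomainRingHom_apply, AddMonoidAlgebra.mapDomain_single]
  have hinj : Function.Injective φ :=
    AddMonoidAlgebra.mapDomain_injective Subtype.val_injective
  set s : Q := ∑ i, q i with hs
  have hu : IsUnit (φ (AddMonoidAlgebra.single s (1 : ℂ))) := by
    rw [hφs]
    refine IsUnit.of_mul_eq_one (AddMonoidAlgebra.single (-(s : G)) (1 : ℂ)) ?_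
    rw [AddMonoidAlgebra.single_mul_single, add_neg_cancel, one_mul]
    rfl
  refine ⟨hinj, hu, ?_⟩
  letI : Algebra (AddMonoidAlgebra ℂ Q) (AddMonoidAlgebra ℂ G) := φ.toAlgebra
  have hsurj : ∀ f : AddMonoidAlgebra ℂ G, ∃ (n : ℕ) (p : AddMonoidAlgebra ℂ Q),
      f * φ (AddMonoidAlgebra.single s (1 : ℂ) ^ n) = φ p := by
    intro f
    induction f using AddMonoidAlgebra.induction_linear with
    | zero => exact ⟨0, 0, by simp⟩
    | add f g hf hg =>
      obtain ⟨a, p, hp⟩ := hf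
      obtain ⟨b, r, hr⟩ := hg
      refine ⟨a + b, p * AddMonoidAlgebra.single s (1 : ℂ) ^ b +
        r * AddMonoidAlgebra.single s (1 : ℂ) ^ a, ?_⟩
      rw [map_add, map_mul, map_mul, ← hp, ← hr, pow_add, map_mul]
      ring
    | single g c =>
      obtain ⟨n, hn⟩ := aux_exists Q hgen m q hq g
      refine ⟨n, AddMonoidAlgebra.single ⟨_, hn⟩ c, ?_⟩
      rw [map_pow, hφs, hφs, AddMonoidAlgebra.single_pow, AddMonoidAlgebra.single_mul_single]
      simp [hs]
  have hloc : IsLocalization (Submonoid.powers (AddMonoidAlgebra.single s (1 : ℂ)))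
      (AddMonoidAlgebra ℂ G) := by
    refine ⟨?_, ?_, ?_⟩
    · rintro ⟨_, n, rfl⟩
      change IsUnit (φ _)
      simp only [map_pow]
      exact hu.pow n
    · intro f
      obtain ⟨n, p, h⟩ := hsurj f
      exact ⟨(p, ⟨_, n, rfl⟩), h⟩
    · intro x y h
      exact ⟨1, by rw [hinj h]⟩
  intro B _ ψ hψ
  have hy : ∀ y : Submonoid.powers (AddMonoidAlgebra.single s (1 : ℂ)), IsUnit (ψ y) := by
    rintro ⟨_, n, rfl⟩
    simp only [map_pow]
    exact hψ.pow n
  refine ⟨IsLocalization.lift hy, IsLocalization.lift_comp hy, ?_⟩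
  intro ψ' h
  apply IsLocalization.ringHom_ext (Submonoid.powers (AddMonoidAlgebra.single s (1 : ℂ)))
  exact h.trans (IsLocalization.lift_comp hy).symm
end

section
/- Let G be a finitely generated abelian group and Q a finitely generated submonoid of G generating G. Then for every minimal prime ideal p of the monoid algebra ℂ[Q], the Krull dimension of the quotient ring ℂ[Q]/p equals the rank of G, that is, the dimension of the ℚ-vector space ℚ ⊗_ℤ G. In particular, ℂ[Q] is pure-dimensional of Krull dimension equal to the rank of G. -/
open scoped TensorProduct

universe v

lemma aux_dim_integral {R S : Type*} [CommRing R] [CommRing S] [Algebra R S]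
    [Algebra.IsIntegral R S] (hinj : Function.Injective (algebraMap R S)) :
    ringKrullDim S = ringKrullDim R := by
  apply le_antisymm
  · refine Order.krullDim_le_of_strictMono (PrimeSpectrum.comap (algebraMap R S)) ?_
    intro I J h
    exact Ideal.IsIntegral.comap_lt_comap (R := R) (I := I.asIdeal) (J := J.asIdeal) h
  · refine iSup_le fun l => ?_
    have : FaithfulSMul R S := (faithfulSMul_iff_algebraMap_injective R S).mpr hinj
    obtain ⟨P, hP⟩ := Algebra.IsIntegral.comap_surjective (R := R) (S := S) (RelSeries.head l)
    have : P.asIdeal.LiesOver (RelSeries.head l).asIdeal := ⟨by rw [← hP]; rfl⟩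
    obtain ⟨L, hL, -, -⟩ := Ideal.exists_ltSeries_of_hasGoingUp (S := S) l P.asIdeal
    rw [← hL]
    exact le_iSup (fun L : LTSeries (PrimeSpectrum S) => ((L.length : ℕ∞) : WithBot ℕ∞)) L

lemma aux_dim_trdeg {A ι : Type*} [CommRing A] [IsDomain A] [Algebra ℂ A]
    [Algebra.FiniteType ℂ A] [Finite ι] {x : ι → A} (hx : IsTranscendenceBasis ℂ x) :
    ringKrullDim A = ((Nat.card ι : ℕ∞) : WithBot ℕ∞) := by
  obtain ⟨s, g, hg, hint⟩ := exists_integral_inj_algHom_of_fg ℂ A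
  have hag : MvPolynomial.aeval (fun i => g (MvPolynomial.X i)) = g := by
    ext i; simp
  have hai : AlgebraicIndependent ℂ (fun i => g (MvPolynomial.X i)) := by
    rw [AlgebraicIndependent, hag]; exact hg
  have htb : IsTranscendenceBasis ℂ (fun i => g (MvPolynomial.X i)) := by
    rw [hai.isTranscendenceBasis_iff_isAlgebraic]
    constructor
    intro a
    apply IsIntegral.isAlgebraic
    obtain ⟨p, hp, hpa⟩ := hint a
    let g' : MvPolynomial (Fin s) ℂ →ₐ[ℂ]
      (Algebra.adjoin ℂ (Set.range fun i => g (MvPolynomial.X i))) :=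
      g.codRestrict _ (fun f => by
        rw [Algebra.adjoin_range_eq_range_aeval, hag]; exact ⟨f, rfl⟩)
    refine ⟨p.map g'.toRingHom, hp.map _, ?_⟩
    rw [Polynomial.eval₂_map]
    exact hpa
  have hc := hx.lift_cardinalMk_eq htb
  have hcard : Nat.card ι = s := by
    have := congrArg Cardinal.toNat hc
    simpa [Nat.card] using this
  rw [hcard]
  let _ := g.toRingHom.toAlgebra
  have : Algebra.IsIntegral (MvPolynomial (Fin s) ℂ) A := ⟨hint⟩
  rw [aux_dim_integral (R := MvPolynomial (Fin s) ℂ) (S := A) hg,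
    MvPolynomial.ringKrullDim_of_isNoetherianRing]
  simp

lemma aux_nzd {M V : Type*} [AddCommMonoid M] [IsCancelAdd M] [AddCommGroup V] [Module ℚ V]
    (π : M →+ V) (f : AddMonoidAlgebra ℂ M) (hf : f ≠ 0)
    (hinj : Set.InjOn π f.coeff.support) : f ∈ nonZeroDivisors (AddMonoidAlgebra ℂ M) := by
  classical
  rw [mem_nonZeroDivisors_iff_right]
  intro g hfg
  by_contra hg
  have hf' : f.coeff.support.Nonempty := by
    rwa [Finsupp.support_nonempty_iff, Ne, AddMonoidAlgebra.coeff_eq_zero]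
  have hg' : g.coeff.support.Nonempty := by
    rwa [Finsupp.support_nonempty_iff, Ne, AddMonoidAlgebra.coeff_eq_zero]
  obtain ⟨a', ha', b', hb', h⟩ := UniqueSums.uniqueAdd_of_nonempty (hf'.image π) (hg'.image π)
  obtain ⟨a, ha, rfl⟩ := Finset.mem_image.1 ha'
  obtain ⟨b, hb, rfl⟩ := Finset.mem_image.1 hb'
  have hu : UniqueAdd f.coeff.support g.coeff.support a b := by
    intro c d hc hd hcd
    have h1 := (h (Finset.mem_image_of_mem π hc) (Finset.mem_image_of_mem π hd)
      (by rw [← map_add, ← map_add, hcd])).1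
    have h2 := hinj hc ha h1
    subst h2
    exact ⟨rfl, add_left_cancel hcd⟩
  have h3 := AddMonoidAlgebra.coeff_mul_add_of_uniqueAdd hu
  rw [mul_comm, hfg] at h3
  rw [Finsupp.mem_support_iff] at ha hb
  exact mul_ne_zero ha hb (by simpa using h3.symm)

lemma aux_basis {M : Type*} {V : Type v} [AddCommMonoid M] [IsCancelAdd M] [AddCommGroup V] [Module ℚ V]
    [FiniteDimensional ℚ V] (π : M →+ V) (hspan : Submodule.span ℚ (Set.range π) = ⊤) :
    ∃ (ι : Type v) (_ : Fintype ι) (B : ι → M), LinearIndependent ℚ (fun i => π (B i)) ∧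
      Submodule.span ℚ (Set.range fun i => π (B i)) = ⊤ ∧ Nat.card ι = Module.finrank ℚ V := by
  obtain ⟨b, hbr, hbs, hbl⟩ := exists_linearIndependent ℚ (Set.range π)
  rw [hspan] at hbs
  choose B hBe using fun i : b => hbr i.2
  have hfin : Finite b := hbl.finite
  have he : (fun i => π (B i)) = ((↑) : b → V) := funext hBe
  refine ⟨b, Fintype.ofFinite b, B, ?_, ?_, ?_⟩
  · rw [he]; exact hbl
  · rw [he, Subtype.range_coe]; exact hbs
  · rw [Module.finrank_eq_nat_card_basis (Module.Basis.mk hbl (by rw [Subtype.range_coe, hbs]))]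

lemma aux_main_s11 {M V : Type*} [AddCommMonoid M] [IsCancelAdd M] [AddMonoid.FG M] [AddCommGroup V] [Module ℚ V]
    [FiniteDimensional ℚ V]
    (π : M →+ V) (hspan : Submodule.span ℚ (Set.range π) = ⊤)
    (hker : ∀ a b, π a = π b → ∃ n : ℕ, 0 < n ∧ n • a = n • b)
    (p : Ideal (AddMonoidAlgebra ℂ M)) (hp : p ∈ minimalPrimes (AddMonoidAlgebra ℂ M)) :
    ringKrullDim (AddMonoidAlgebra ℂ M ⧸ p) = ((Module.finrank ℚ V : ℕ∞) : WithBot ℕ∞) := by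
  classical
  have : p.IsPrime := hp.1.1
  obtain ⟨ι, _, B, hB, hBspan, hcard⟩ := aux_basis π hspan
  let φ : (ι →₀ ℕ) →+ M := Finsupp.liftAddHom (fun i => (multiplesHom M) (B i))
  have hφ : ∀ v : ι →₀ ℕ, π (φ v) = ∑ i, (v i : ℚ) • π (B i) := by
    intro v
    simp [φ, Finsupp.sum_fintype, map_sum, map_nsmul, Nat.cast_smul_eq_nsmul]
  have hπφ : Function.Injective (fun v => π (φ v)) := by
    intro v w h
    simp only [hφ] at h
    have h2 : ∑ i, ((v i : ℚ) - w i) • π (B i) = 0 := by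
      simp [sub_smul, Finset.sum_sub_distrib, h]
    ext i
    have := Fintype.linearIndependent_iff.1 hB _ h2 i
    exact_mod_cast sub_eq_zero.1 this
  let χ : M → AddMonoidAlgebra ℂ M ⧸ p := fun m => Ideal.Quotient.mk p (AddMonoidAlgebra.single m 1)
  have hχadd : ∀ a b, χ (a + b) = χ a * χ b := by
    intro a b; simp [χ, ← map_mul, AddMonoidAlgebra.single_mul_single]
  have hχn : ∀ (n : ℕ) a, χ (n • a) = χ a ^ n := by
    intro n a; simp [χ, ← map_pow, AddMonoidAlgebra.single_pow]
  have hnot : ∀ f ∈ nonZeroDivisors (AddMonoidAlgebra ℂ M), Ideal.Quotient.mk p f ≠ 0 := by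
    intro f hf h0
    rw [Ideal.Quotient.eq_zero_iff_mem] at h0
    exact notMem_nonZeroDivisors_of_mem_mem_minimalPrimes h0 hp hf
  have hχ0 : ∀ a, χ a ≠ 0 := by
    intro a
    refine hnot _ (aux_nzd π _ (by simp) ?_)
    intro x hx y hy _
    have h1 := Finsupp.support_single_subset hx
    have h2 := Finsupp.support_single_subset hy
    simp at h1 h2
    rw [h1, h2]
  have haev : (MvPolynomial.aeval (fun i => χ (B i)) : MvPolynomial ι ℂ →ₐ[ℂ] _)
      = (Ideal.Quotient.mkₐ ℂ p).comp (AddMonoidAlgebra.mapDomainAlgHom ℂ ℂ φ) := by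
    ext i
    rw [MvPolynomial.aeval_X]
    simp [MvPolynomial.X, MvPolynomial.monomial, χ, φ]
  have hai : AlgebraicIndependent ℂ (fun i => χ (B i)) := by
    rw [AlgebraicIndependent, haev, injective_iff_map_eq_zero]
    intro f hf
    by_contra hf0
    have hφi : Function.Injective φ := fun a b h => hπφ (congrArg π h)
    refine hnot (AddMonoidAlgebra.mapDomain φ f) (aux_nzd π _ ?_ ?_) hf
    · intro h
      exact hf0 (AddMonoidAlgebra.mapDomain_injective hφi (by simpa using h))
    · intro x hx y hy hxy
      have h1 := Finsupp.mapDomain_support hx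
      have h2 := Finsupp.mapDomain_support hy
      obtain ⟨v, -, rfl⟩ := Finset.mem_image.1 h1
      obtain ⟨w, -, rfl⟩ := Finset.mem_image.1 h2
      rw [hπφ hxy]
  have hkey : ∀ m, ∃ (n : ℕ) (v w : ι →₀ ℕ), 0 < n ∧ n • m + φ v = φ w := by
    intro m
    obtain ⟨c, hc⟩ := (Submodule.mem_span_range_iff_exists_fun ℚ).1
      (hBspan ▸ Submodule.mem_top : π m ∈ Submodule.span ℚ (Set.range fun i => π (B i)))
    let d : ℕ := ∏ i, (c i).den
    have hd : 0 < d := Finset.prod_pos fun i _ => (c i).den_pos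
    have hz : ∀ i, ∃ z : ℤ, (d : ℚ) * c i = z := by
      intro i
      obtain ⟨k, hk⟩ : (c i).den ∣ d := Finset.dvd_prod_of_mem _ (Finset.mem_univ i)
      refine ⟨k * (c i).num, ?_⟩
      rw [hk]
      push_cast
      rw [mul_comm ((c i).den : ℚ), mul_assoc, Rat.den_mul_eq_num]
    choose z hz using hz
    let v : ι →₀ ℕ := Finsupp.equivFunOnFinite.symm fun i => (-z i).toNat
    let w : ι →₀ ℕ := Finsupp.equivFunOnFinite.symm fun i => (z i).toNat
    have hvw : π (d • m + φ v) = π (φ w) := by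
      rw [map_add, map_nsmul, hφ, hφ, ← hc, ← Nat.cast_smul_eq_nsmul ℚ, Finset.smul_sum,
        ← Finset.sum_add_distrib]
      refine Finset.sum_congr rfl fun i _ => ?_
      rw [smul_smul, hz, ← add_smul]
      congr 1
      have : z i + ((-z i).toNat : ℤ) = ((z i).toNat : ℤ) := by omega
      exact_mod_cast this
    obtain ⟨n, hn, h⟩ := hker _ _ hvw
    refine ⟨n * d, n • v, n • w, Nat.mul_pos hn hd, ?_⟩
    rw [map_nsmul, map_nsmul, ← h, nsmul_add, mul_nsmul']
  have htb : IsTranscendenceBasis ℂ (fun i => χ (B i)) := by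
    rw [hai.isTranscendenceBasis_iff_isAlgebraic]
    set S := Algebra.adjoin ℂ (Set.range fun i => χ (B i)) with hS
    have hmem : ∀ v, χ (φ v) ∈ S := by
      intro v
      rw [hS, Algebra.adjoin_range_eq_range_aeval, haev]
      refine ⟨AddMonoidAlgebra.single v 1, ?_⟩
      simp [χ]
    have hχalg : ∀ m, IsAlgebraic S (χ m) := by
      intro m
      obtain ⟨n, v, w, hn, h⟩ := hkey m
      refine ⟨Polynomial.C ⟨χ (φ v), hmem v⟩ * Polynomial.X ^ n -
        Polynomial.C ⟨χ (φ w), hmem w⟩, ?_, ?_⟩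
      · intro h0
        have h1 := congrArg (fun q => Polynomial.coeff q n) h0
        simp [Polynomial.coeff_C, hn.ne'] at h1
        exact hχ0 _ (congrArg Subtype.val h1)
      · simp only [map_sub, map_mul, Polynomial.aeval_C, map_pow, Polynomial.aeval_X]
        rw [← hχn]
        change χ (φ v) * χ (n • m) - χ (φ w) = 0
        rw [← hχadd, ← h, add_comm, sub_self]
    constructor
    intro a
    obtain ⟨f, rfl⟩ := Ideal.Quotient.mk_surjective a
    induction f using AddMonoidAlgebra.induction_linear with
    | zero => rw [map_zero]; exact isAlgebraic_zero
    | add f g hf hg => rw [map_add]; exact hf.add hg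
    | single m c =>
      have : Ideal.Quotient.mk p (AddMonoidAlgebra.single m c) =
          algebraMap S _ (algebraMap ℂ S c) * χ m := by
        rw [← IsScalarTower.algebraMap_apply ℂ S, ← Algebra.smul_def]
        change _ = c • Ideal.Quotient.mkₐ ℂ p _
        rw [← map_smul]
        simp
      rw [this]
      exact (isAlgebraic_algebraMap _).mul (hχalg m)
  rw [aux_dim_trdeg htb, hcard]

theorem stmt_11 {G : Type*} [AddCommGroup G] [AddGroup.FG G]
    (Q : AddSubmonoid G) (hfg : Q.FG)
    (hgen : AddSubgroup.closure (Q : Set G) = ⊤) :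
    (∀ p ∈ minimalPrimes (AddMonoidAlgebra ℂ Q),
      ringKrullDim (AddMonoidAlgebra ℂ Q ⧸ p)
        = ((Module.finrank ℚ (ℚ ⊗[ℤ] G) : ℕ∞) : WithBot ℕ∞)) ∧
    ringKrullDim (AddMonoidAlgebra ℂ Q)
      = ((Module.finrank ℚ (ℚ ⊗[ℤ] G) : ℕ∞) : WithBot ℕ∞) := by
  have : AddMonoid.FG Q := (AddMonoid.fg_iff_addSubmonoid_fg Q).mpr hfg
  have : Module.Finite ℤ G := Module.Finite.iff_addGroup_fg.mpr inferInstance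
  have h1 : ∀ p ∈ minimalPrimes (AddMonoidAlgebra ℂ Q),
      ringKrullDim (AddMonoidAlgebra ℂ Q ⧸ p)
        = ((Module.finrank ℚ (ℚ ⊗[ℤ] G) : ℕ∞) : WithBot ℕ∞) := by
    let τ : G →ₗ[ℤ] ℚ ⊗[ℤ] G := TensorProduct.mk ℤ ℚ G 1
    have : IsLocalizedModule (nonZeroDivisors ℤ) τ :=
      IsLocalization.tensorProduct_isLocalizedModule _ _
    have : IsCancelAdd Q := inferInstance
    refine aux_main_s11 (M := Q) (V := ℚ ⊗[ℤ] G) (τ.toAddMonoidHom.comp Q.subtype) ?_ ?_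
    · rw [eq_top_iff]
      have hG : ∀ g : G, τ g ∈
          Submodule.span ℚ (Set.range (τ.toAddMonoidHom.comp Q.subtype)) := by
        intro g
        have hg : g ∈ AddSubgroup.closure (Q : Set G) := hgen ▸ AddSubgroup.mem_top g
        induction hg using AddSubgroup.closure_induction with
        | mem x hx => exact Submodule.subset_span ⟨⟨x, hx⟩, rfl⟩
        | zero => rw [map_zero]; exact zero_mem _
        | add x y _ _ hx hy => rw [map_add]; exact add_mem hx hy
        | neg x _ hx => rw [map_neg]; exact neg_mem hx
      rintro x -
      induction x using TensorProduct.induction_on with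
      | zero => exact zero_mem _
      | add x y hx hy => exact add_mem hx hy
      | tmul r g =>
        have : r ⊗ₜ[ℤ] g = r • τ g := by
          change _ = r • ((1 : ℚ) ⊗ₜ[ℤ] g)
          rw [TensorProduct.smul_tmul']; simp
        rw [this]
        exact Submodule.smul_mem _ _ (hG g)
    · intro a b hab
      obtain ⟨c, hc⟩ := IsLocalizedModule.exists_of_eq (S := nonZeroDivisors ℤ) (f := τ) hab
      have hc0 : (c : ℤ) ≠ 0 := nonZeroDivisors.ne_zero c.2
      refine ⟨(c : ℤ).natAbs, Int.natAbs_pos.2 hc0, ?_⟩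
      have hc : (c : ℤ) • (a : G) = (c : ℤ) • (b : G) := hc
      ext
      push_cast
      rcases Int.natAbs_eq (c : ℤ) with h | h <;> rw [h] at hc <;>
        simpa only [neg_smul, neg_inj, natCast_zsmul] using hc
  refine ⟨h1, le_antisymm ?_ ?_⟩
  · refine iSup_le fun l => ?_
    obtain ⟨p, hp, hpl⟩ := Ideal.exists_minimalPrimes_le (J := l.head.asIdeal) bot_le
    rw [← h1 p hp, ringKrullDim_quotient]
    exact le_iSup (fun L : LTSeries (PrimeSpectrum.zeroLocus (R := AddMonoidAlgebra ℂ Q) p) =>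
      ((L.length : ℕ∞) : WithBot ℕ∞))
      { length := l.length
        toFun := fun i => ⟨l i, hpl.trans (LTSeries.head_le l i)⟩
        step := l.step }
  · obtain ⟨p, hp⟩ := (Ideal.nonempty_minimalPrimes (I := (⊥ : Ideal (AddMonoidAlgebra ℂ Q))) bot_ne_top)
    rw [← h1 p hp]
    exact ringKrullDim_quotient_le p
end

section
/- Let G be a finitely generated abelian group and Q a finitely generated submonoid of G generating G. Then the set of minimal prime ideals of the monoid algebra ℂ[Q] is finite, of cardinality equal to the order of the torsion subgroup of G. (Equivalently, the scheme V_Q = Spec ℂ[Q] has exactly |G_tor| irreducible components.) -/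
theorem aux_minPrimes {R ι : Type*} [CommRing R] [Fintype ι] (P : ι → Ideal R)
    (hP : ∀ i, (P i).IsPrime) (h0 : ∀ x, (∀ i, x ∈ P i) → x = 0)
    (hinc : ∀ i j, P i ≤ P j → i = j) :
    minimalPrimes R = Set.range P := by
  have key : ∀ p : Ideal R, p.IsPrime → ∃ i, P i ≤ p := by
    intro p hp
    have : (Finset.univ : Finset ι).inf P ≤ p := by
      intro x hx
      rw [Submodule.mem_finsetInf] at hx
      rw [h0 x (fun i => hx i (Finset.mem_univ i))]
      exact p.zero_mem
    obtain ⟨i, -, hi⟩ := hp.inf_le'.1 this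
    exact ⟨i, hi⟩
  ext p
  rw [minimalPrimes_eq_minimals]
  constructor
  · rintro ⟨hp, hmin⟩
    obtain ⟨i, hi⟩ := key p hp
    exact ⟨i, le_antisymm hi (hmin (hP i) hi)⟩
  · rintro ⟨i, rfl⟩
    refine ⟨hP i, ?_⟩
    intro q hq hle
    obtain ⟨j, hj⟩ := key q hq
    have := hinc j i (hj.trans hle)
    subst this
    exact hj

noncomputable def auxHom {G F T : Type*} [AddCommGroup G] [AddCommGroup F] [AddCommGroup T]
    (Q : AddSubmonoid G) (p : G →+ F) (r : G →+ T) (ψ : AddChar T ℂ) :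
    AddMonoidAlgebra ℂ Q →ₐ[ℂ] AddMonoidAlgebra ℂ F :=
  AddMonoidAlgebra.lift ℂ _ Q
    { toFun := fun q => AddMonoidAlgebra.single (p (q.toAdd : G)) (ψ (r (q.toAdd : G)))
      map_one' := by simp [AddMonoidAlgebra.one_def]
      map_mul' := by
        intro a b
        simp [AddMonoidAlgebra.single_mul_single, AddChar.map_add_eq_mul] }

theorem auxHom_single {G F T : Type*} [AddCommGroup G] [AddCommGroup F] [AddCommGroup T]
    (Q : AddSubmonoid G) (p : G →+ F) (r : G →+ T) (ψ : AddChar T ℂ) (q : Q) (a : ℂ) :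
    auxHom Q p r ψ (AddMonoidAlgebra.single q a)
      = AddMonoidAlgebra.single (p q) (a * ψ (r q)) := by
  simp [auxHom, AddMonoidAlgebra.lift_single]

theorem aux_coeff {G F T : Type*} [AddCommGroup G] [AddCommGroup F] [AddCommGroup T] [Fintype T]
    (Q : AddSubmonoid G) (p : G →+ F) (r : G →+ T)
    (hinj : ∀ g, p g = 0 → r g = 0 → g = 0) (q₀ : Q) (f : AddMonoidAlgebra ℂ Q) :
    ∑ ψ : AddChar T ℂ, ψ (-(r q₀)) * (auxHom Q p r ψ f).coeff (p q₀)
      = (Fintype.card T : ℂ) * f.coeff q₀ := by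
  classical
  induction f using AddMonoidAlgebra.induction_linear with
  | zero => simp
  | add x y hx hy => simp [mul_add, Finset.sum_add_distrib, hx, hy]
  | single q a =>
    simp only [auxHom_single, AddMonoidAlgebra.coeff_single, Finsupp.single_apply]
    by_cases h : p q = p q₀
    · have e : ∀ ψ : AddChar T ℂ, ψ (-(r q₀)) * (a * ψ (r q)) = a * ψ (r (q - q₀ : G)) := by
        intro ψ
        rw [map_sub, sub_eq_add_neg, AddChar.map_add_eq_mul]; ring
      simp only [h, if_true, e, ← Finset.mul_sum, AddChar.sum_apply_eq_ite]
      by_cases h2 : q = q₀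
      · subst h2; simp [mul_comm]
      · have : r (q - q₀ : G) ≠ 0 := by
          intro h3
          exact h2 (Subtype.ext (sub_eq_zero.1 (hinj _ (by simp [h]) h3)))
        rw [if_neg this]; simp [h2]
    · have h2 : q ≠ q₀ := by rintro rfl; exact h rfl
      simp [h, h2]

theorem aux_main_s12 {G F T : Type*} [AddCommGroup G] [AddCommGroup F] [UniqueSums F]
    [AddCommGroup T] [Finite T]
    (Q : AddSubmonoid G) (hgen : AddSubgroup.closure (Q : Set G) = ⊤) (p : G →+ F) (r : G →+ T)
    (hinj : ∀ g, p g = 0 → r g = 0 → g = 0) (hsurj : ∀ t, ∃ g, p g = 0 ∧ r g = t) :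
    (minimalPrimes (AddMonoidAlgebra ℂ Q)).Finite ∧
    Nat.card (minimalPrimes (AddMonoidAlgebra ℂ Q)) = Nat.card T := by
  classical
  have := Fintype.ofFinite T
  have hinc : ∀ ψ ψ' : AddChar T ℂ, RingHom.ker (auxHom Q p r ψ) ≤ RingHom.ker (auxHom Q p r ψ') →
      ψ = ψ' := by
    intro ψ ψ' hle
    ext t
    obtain ⟨g, hg, rfl⟩ := hsurj t
    have hd : ∀ g ∈ AddSubgroup.closure (Q : Set G), ∃ a b : Q, g = a - b := by
      intro g hg
      induction hg using AddSubgroup.closure_induction with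
      | mem x hx => exact ⟨⟨x, hx⟩, 0, by simp⟩
      | zero => exact ⟨0, 0, by simp⟩
      | add x y _ _ hx hy =>
        obtain ⟨a, b, rfl⟩ := hx
        obtain ⟨c, d, rfl⟩ := hy
        exact ⟨a + c, b + d, by push_cast; abel⟩
      | neg x _ hx =>
        obtain ⟨a, b, rfl⟩ := hx
        exact ⟨b, a, by abel⟩
    obtain ⟨a, b, rfl⟩ := hd g (by rw [hgen]; trivial)
    have hpab : p a = p b := by rwa [map_sub, sub_eq_zero] at hg
    have hra : ∀ φ : AddChar T ℂ, φ (r a) = φ (r (a - b : G)) * φ (r b) := by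
      intro φ
      rw [← AddChar.map_add_eq_mul, ← map_add, sub_add_cancel]
    have hm : AddMonoidAlgebra.single a (1 : ℂ)
        - AddMonoidAlgebra.single b (ψ (r (a - b : G))) ∈ RingHom.ker (auxHom Q p r ψ) := by
      rw [RingHom.mem_ker, map_sub, auxHom_single, auxHom_single, hpab, one_mul, hra ψ, sub_self]
    have hm' := hle hm
    rw [RingHom.mem_ker, map_sub, auxHom_single, auxHom_single, hpab, one_mul, hra ψ',
      sub_eq_zero] at hm'
    have := congrArg (fun f => f.coeff (p b)) hm'
    simp only [AddMonoidAlgebra.coeff_single, Finsupp.single_eq_same] at this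
    exact (mul_right_cancel₀ (AddChar.val_isUnit _ _).ne_zero this).symm
  have hmain := aux_minPrimes (fun ψ : AddChar T ℂ => RingHom.ker (auxHom Q p r ψ))
    (fun ψ => RingHom.ker_isPrime _) (by
      intro f hf
      ext q
      have h := aux_coeff Q p r hinj q f
      have hf' : ∀ ψ, auxHom Q p r ψ f = 0 := fun ψ => hf ψ
      simp only [hf'] at h
      simpa using h) hinc
  rw [hmain]
  refine ⟨Set.finite_range _, ?_⟩
  rw [Nat.card_range_of_injective (fun ψ ψ' h => hinc ψ ψ' (le_of_eq h)),
    Nat.card_eq_fintype_card, Nat.card_eq_fintype_card, AddChar.card_eq]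

/-- `V_Q` has exactly `|G_tor|` irreducible components: for a finitely generated
submonoid `Q` of a finitely generated abelian group `G` generating `G`, the set of
minimal primes of `ℂ[Q]` is finite, of cardinality the order of the torsion
subgroup of `G`. -/
theorem stmt_12 {G : Type*} [AddCommGroup G] [AddGroup.FG G]
    (Q : AddSubmonoid G) (hfg : Q.FG)
    (hgen : AddSubgroup.closure (Q : Set G) = ⊤) :
    (minimalPrimes (AddMonoidAlgebra ℂ Q)).Finite ∧
    Nat.card (minimalPrimes (AddMonoidAlgebra ℂ Q))
      = Nat.card {g : G // ∃ n : ℕ, 1 ≤ n ∧ n • g = 0} := by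
  have hfin : Module.Finite ℤ G := Module.Finite.iff_addGroup_fg.mpr inferInstance
  let T := Submodule.torsion ℤ G
  have hT : Finite T := Module.finite_of_fg_torsion T (Submodule.torsion_isTorsion)
  have htf : Module.IsTorsionFree ℤ (G ⧸ T) := inferInstance
  have : Module.Free ℤ (G ⧸ T) := inferInstance
  have : UniqueSums (G ⧸ T) := UniqueSums.of_injective_addHom
    (Module.Free.chooseBasis ℤ (G ⧸ T)).repr.toLinearMap.toAddMonoidHom.toAddHom
    (Module.Free.chooseBasis ℤ (G ⧸ T)).repr.injective inferInstance
  obtain ⟨s, hs⟩ := Module.projective_lifting_property T.mkQ LinearMap.id T.mkQ_surjective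
  have hs' : ∀ x, T.mkQ (s x) = x := fun x => LinearMap.congr_fun hs x
  let r : G →ₗ[ℤ] T := LinearMap.codRestrict T (LinearMap.id - s ∘ₗ T.mkQ) (by
    intro g
    refine (Submodule.Quotient.mk_eq_zero T).1 ?_
    rw [← Submodule.mkQ_apply]
    simp only [LinearMap.sub_apply, LinearMap.id_apply, LinearMap.comp_apply, map_sub, hs',
      sub_self])
  have hr : ∀ g, (r g : G) = g - s (T.mkQ g) := fun g => rfl
  have h := aux_main_s12 Q hgen T.mkQ.toAddMonoidHom r.toAddMonoidHom
    (by
      intro g h1 h2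
      have h1' : T.mkQ g = 0 := h1
      have h2' : r g = 0 := h2
      have := hr g
      rw [h1', h2'] at this
      simpa using this.symm)
    (by
      intro t
      have ht : T.mkQ (t : G) = 0 := by simp
      refine ⟨t, ht, Subtype.ext ?_⟩
      change (r (t : G) : G) = t
      rw [hr, ht]; simp)
  refine ⟨h.1, h.2.trans (Nat.card_congr (Equiv.subtypeEquivRight fun g => ?_))⟩
  rw [Submodule.mem_torsion_iff]
  constructor
  · rintro ⟨⟨a, ha⟩, h⟩
    have ha0 : a ≠ 0 := nonZeroDivisors.ne_zero ha
    have h' : a • g = 0 := h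
    refine ⟨a.natAbs, Int.natAbs_pos.2 ha0, ?_⟩
    rcases Int.natAbs_eq a with e | e
    · rw [e] at h'; simpa using h'
    · rw [e] at h'; simpa using h'
  · rintro ⟨n, hn, h⟩
    refine ⟨⟨n, mem_nonZeroDivisors_of_ne_zero (by omega)⟩, ?_⟩
    change (n : ℤ) • g = 0
    simpa using h
end

section
/- Let G be a finitely generated abelian group and Q a finitely generated submonoid of G generating G. Inside the monoid algebra ℂ[G], let A be the ℂ-subalgebra spanned by {χ^q : q ∈ Q} and let B be the ℂ-subalgebra spanned by {χ^s : s ∈ Q^sat}, where Q^sat = {g ∈ G : ∃ n ≥ 1, n•g ∈ Q}. Then B equals the integral closure of A in ℂ[G]. (This expresses that the morphism V_{Q^sat} → V_Q induced by Q ⊆ Q^sat is the normalization of V_Q.) -/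
theorem aux_char {G : Type*} [AddCommGroup G] (g h : G) (hgh : g ≠ h) :
    ∃ φ : Multiplicative G →* ℂ, φ (.ofAdd g) ≠ φ (.ofAdd h) := by
  obtain ⟨c, hc⟩ := CharacterModule.exists_character_apply_ne_zero_of_ne_zero (sub_ne_zero.2 hgh)
  let c' : G →+ AddCircle (1 : ℚ) := c
  have hc' : c' (g - h) ≠ 0 := hc
  let m : AddCircle (1 : ℚ) →+ AddCircle (1 : ℝ) :=
    QuotientAddGroup.map _ _ (Rat.castHom ℝ).toAddMonoidHom (by
      intro x hx
      obtain ⟨n, rfl⟩ := AddSubgroup.mem_zmultiples_iff.1 hx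
      exact AddSubgroup.mem_comap.2 (AddSubgroup.mem_zmultiples_iff.2 ⟨n, by simp⟩))
  have hm : ∀ x, m x = 0 → x = 0 := by
    intro x
    induction x using QuotientAddGroup.induction_on with
    | H x =>
      intro hx
      have hx' : (((x : ℝ)) : AddCircle (1 : ℝ)) = 0 := hx
      obtain ⟨n, hn⟩ := AddSubgroup.mem_zmultiples_iff.1 ((QuotientAddGroup.eq_zero_iff _).1 hx')
      refine (QuotientAddGroup.eq_zero_iff _).2 (AddSubgroup.mem_zmultiples_iff.2 ⟨n, ?_⟩)
      have : ((n • (1 : ℚ) : ℚ) : ℝ) = x := by rw [← hn]; simp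
      exact_mod_cast this
  refine ⟨{ toFun := fun k => ((AddCircle.toCircle (m (c' k.toAdd)) : Circle) : ℂ)
            map_one' := by simp
            map_mul' := by intro x y; simp [AddCircle.toCircle_add] }, ?_⟩
  intro heq
  have h1 : AddCircle.toCircle (m (c' g)) = AddCircle.toCircle (m (c' h)) := Subtype.ext heq
  have h2 := AddCircle.injective_toCircle one_ne_zero h1
  apply hc'
  apply hm
  rw [map_sub, map_sub, h2, sub_self]

/-- the twist by a character -/
noncomputable def auxTwist {G : Type*} [AddCommGroup G] (φ : Multiplicative G →* ℂ) :
    AddMonoidAlgebra ℂ G →ₐ[ℂ] AddMonoidAlgebra ℂ G :=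
  AddMonoidAlgebra.lift ℂ (AddMonoidAlgebra ℂ G) G
    { toFun := fun k => AddMonoidAlgebra.single k.toAdd (φ k)
      map_one' := by simp [AddMonoidAlgebra.one_def]
      map_mul' := by intro x y; simp [AddMonoidAlgebra.single_mul_single] }

theorem auxTwist_single {G : Type*} [AddCommGroup G] (φ : Multiplicative G →* ℂ) (g : G) (r : ℂ) :
    auxTwist φ (AddMonoidAlgebra.single g r) = AddMonoidAlgebra.single g (r * φ (.ofAdd g)) := by
  simp [auxTwist]

theorem auxTwist_coeff {G : Type*} [AddCommGroup G] (φ : Multiplicative G →* ℂ)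
    (x : AddMonoidAlgebra ℂ G) (g : G) :
    (auxTwist φ x).coeff g = x.coeff g * φ (.ofAdd g) := by
  classical
  induction x using AddMonoidAlgebra.induction_linear with
  | zero => simp
  | add x y hx hy => simp [hx, hy, add_mul]
  | single a b =>
    rw [auxTwist_single, AddMonoidAlgebra.coeff_single_apply, AddMonoidAlgebra.coeff_single_apply]
    split_ifs with h
    · rw [h]
    · simp

theorem aux_support {G : Type*} [AddCommGroup G] (Q : AddSubmonoid G) (x : AddMonoidAlgebra ℂ G)
    (hx : x ∈ Algebra.adjoin ℂ
      ((fun g : G => AddMonoidAlgebra.single g (1 : ℂ)) '' (Q : Set G))) :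
    ∀ g ∈ x.coeff.support, g ∈ Q := by
  classical
  induction hx using Algebra.adjoin_induction with
  | mem x hx =>
    obtain ⟨q, hq, rfl⟩ := hx
    intro g hg
    rw [Finsupp.mem_support_iff, AddMonoidAlgebra.coeff_single_apply] at hg
    split_ifs at hg with h
    · exact h ▸ hq
    · simp at hg
  | algebraMap r =>
    intro g hg
    rw [Finsupp.mem_support_iff, AddMonoidAlgebra.coe_algebraMap, Function.comp_apply,
      AddMonoidAlgebra.coeff_single_apply] at hg
    split_ifs at hg with h
    · exact h ▸ Q.zero_mem
    · simp at hg
  | add x y _ _ hx hy =>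
    intro g hg
    rcases Finset.mem_union.1 (Finsupp.support_add hg) with h | h
    · exact hx g h
    · exact hy g h
  | mul x y _ _ hx hy =>
    intro g hg
    obtain ⟨a, ha, b, hb, rfl⟩ := Finset.mem_add.1
      (AddMonoidAlgebra.support_coeff_mul_subset x y hg)
    exact Q.add_mem (hx a ha) (hy b hb)

theorem aux_twist_integral {G : Type*} [AddCommGroup G] (S : Set G)
    (A : Subalgebra ℂ (AddMonoidAlgebra ℂ G))
    (hA : A = Algebra.adjoin ℂ ((fun g : G => AddMonoidAlgebra.single g (1 : ℂ)) '' S))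
    (φ : Multiplicative G →* ℂ) (x : AddMonoidAlgebra ℂ G) (hx : IsIntegral A x) :
    IsIntegral A (auxTwist φ x) := by
  have hmem : ∀ a ∈ A, auxTwist φ a ∈ A := by
    have : A ≤ A.comap (auxTwist φ) := by
      conv_lhs => rw [hA]
      refine Algebra.adjoin_le ?_
      rintro _ ⟨s, hs, rfl⟩
      change auxTwist φ (AddMonoidAlgebra.single s 1) ∈ A
      rw [auxTwist_single, one_mul]
      have h1 : AddMonoidAlgebra.single s (1 : ℂ) ∈ A := hA ▸ Algebra.subset_adjoin ⟨s, hs, rfl⟩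
      have := A.smul_mem h1 (φ (.ofAdd s))
      simpa using this
    exact this
  exact hx.map_of_comp_eq
    (((auxTwist φ).comp A.val).codRestrict A (fun a => hmem a a.2)).toRingHom
    (auxTwist φ).toRingHom (by ext a; rfl)

theorem aux_mono {G : Type*} [AddCommGroup G] (S : Set G)
    (A : Subalgebra ℂ (AddMonoidAlgebra ℂ G))
    (hA : A = Algebra.adjoin ℂ ((fun g : G => AddMonoidAlgebra.single g (1 : ℂ)) '' S)) (g : G) :
    ∀ (n : ℕ) (x : AddMonoidAlgebra ℂ G), x.coeff.support.card = n → IsIntegral A x →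
      x.coeff g ≠ 0 → IsIntegral A (AddMonoidAlgebra.single g (1 : ℂ)) := by
  classical
  have hsmul : ∀ (r : ℂ) (y : AddMonoidAlgebra ℂ G), IsIntegral A y → IsIntegral A (r • y) := by
    intro r y hy
    have := (isIntegral_algebraMap (R := A) (A := AddMonoidAlgebra ℂ G)
      (x := algebraMap ℂ A r)).mul hy
    rwa [← IsScalarTower.algebraMap_apply, ← Algebra.smul_def] at this
  intro n
  induction n using Nat.strong_induction_on with
  | _ n ih =>
    intro x hn hx hg
    by_cases hex : ∃ h, h ≠ g ∧ x.coeff h ≠ 0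
    · obtain ⟨h, hhg, hh⟩ := hex
      obtain ⟨φ, hφ⟩ := aux_char g h hhg.symm
      have hy : ∀ k, (auxTwist φ x - φ (.ofAdd h) • x).coeff k
          = x.coeff k * (φ (.ofAdd k) - φ (.ofAdd h)) := by
        intro k
        rw [AddMonoidAlgebra.coeff_sub, Finsupp.sub_apply, auxTwist_coeff,
          AddMonoidAlgebra.coeff_smul_apply, smul_eq_mul]
        ring
      refine ih _ ?_ (auxTwist φ x - φ (.ofAdd h) • x) rfl
        ((aux_twist_integral S A hA φ x hx).sub (hsmul _ _ hx)) ?_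
      · rw [← hn]
        refine Finset.card_lt_card (Finset.ssubset_iff_of_subset ?_ |>.2 ⟨h, ?_, ?_⟩)
        · intro k hk
          rw [Finsupp.mem_support_iff, hy] at hk
          exact Finsupp.mem_support_iff.2 (left_ne_zero_of_mul hk)
        · exact Finsupp.mem_support_iff.2 hh
        · rw [Finsupp.mem_support_iff, hy]; simp
      · rw [hy]
        exact mul_ne_zero hg (sub_ne_zero.2 hφ)
    · push Not at hex
      have hxe : AddMonoidAlgebra.single g (1 : ℂ) = (x.coeff g)⁻¹ • x := by
        ext k
        rw [AddMonoidAlgebra.coeff_single_apply, AddMonoidAlgebra.coeff_smul_apply]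
        split_ifs with h
        · subst h; simp [hg]
        · simp [hex k (Ne.symm h)]
      rw [hxe]
      exact hsmul _ _ hx

theorem aux_sat {G : Type*} [AddCommGroup G] (Q : AddSubmonoid G)
    (A : Subalgebra ℂ (AddMonoidAlgebra ℂ G))
    (hA : A = Algebra.adjoin ℂ
      ((fun g : G => AddMonoidAlgebra.single g (1 : ℂ)) '' (Q : Set G))) (g : G)
    (h : IsIntegral A (AddMonoidAlgebra.single g (1 : ℂ))) :
    ∃ n : ℕ, 1 ≤ n ∧ n • g ∈ Q := by
  classical
  obtain ⟨p, hp, hp0⟩ := h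
  have hpow : ∀ i : ℕ, (AddMonoidAlgebra.single g (1 : ℂ)) ^ i
      = AddMonoidAlgebra.single (i • g) (1 : ℂ) := by
    intro i; rw [AddMonoidAlgebra.single_pow, one_pow]
  rw [Polynomial.eval₂_eq_sum_range, Finset.sum_range_succ, hp.coeff_natDegree, map_one, one_mul,
    hpow] at hp0
  have hc := congrArg (fun y => AddMonoidAlgebra.coeff y (p.natDegree • g)) hp0
  simp only [AddMonoidAlgebra.coeff_add, Finsupp.add_apply, AddMonoidAlgebra.coeff_single,
    Finsupp.single_eq_same, AddMonoidAlgebra.coeff_zero, Finsupp.zero_apply] at hc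
  have hne : (∑ i ∈ Finset.range p.natDegree, (algebraMap A (AddMonoidAlgebra ℂ G) (p.coeff i)) *
      (AddMonoidAlgebra.single g (1 : ℂ)) ^ i).coeff (p.natDegree • g) ≠ 0 := by
    intro h0
    rw [h0] at hc
    simp at hc
  rw [AddMonoidAlgebra.coeff_sum, Finsupp.finsetSum_apply] at hne
  obtain ⟨i, hi, hi0⟩ := Finset.exists_ne_zero_of_sum_ne_zero hne
  rw [Finset.mem_range] at hi
  rw [hpow] at hi0
  obtain ⟨a, ha, b, hb, hab⟩ := Finset.mem_add.1
    (AddMonoidAlgebra.support_coeff_mul_subset _ _ (Finsupp.mem_support_iff.2 hi0))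
  have haQ : a ∈ Q := aux_support Q _ (hA ▸ (p.coeff i).2) a ha
  have hb' : b = i • g := by
    rw [Finsupp.mem_support_iff, AddMonoidAlgebra.coeff_single_apply] at hb
    split_ifs at hb with hh
    · exact hh.symm
    · simp at hb
  refine ⟨p.natDegree - i, by omega, ?_⟩
  have : (p.natDegree - i) • g = a := by
    rw [sub_nsmul _ hi.le, ← hab, hb']; abel
  rwa [this]


/-- Normalization of `V_Q`: inside `ℂ[G]`, the subalgebra generated by the monomials
`χ^s` for `s` in the saturation `Q^sat` is the integral closure of the subalgebra
generated by the monomials `χ^q` for `q ∈ Q`. -/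
theorem stmt_13 {G : Type*} [AddCommGroup G] [AddGroup.FG G]
    (Q : AddSubmonoid G) (hfg : Q.FG)
    (hgen : AddSubgroup.closure (Q : Set G) = ⊤)
    (A B : Subalgebra ℂ (AddMonoidAlgebra ℂ G))
    (hA : A = Algebra.adjoin ℂ
      ((fun g : G => AddMonoidAlgebra.single g (1 : ℂ)) '' (Q : Set G)))
    (hB : B = Algebra.adjoin ℂ
      ((fun g : G => AddMonoidAlgebra.single g (1 : ℂ)) ''
        {g : G | ∃ n : ℕ, 1 ≤ n ∧ n • g ∈ Q})) :
    ∀ x : AddMonoidAlgebra ℂ G, x ∈ B ↔ IsIntegral A x := by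

  intro x
  constructor
  · have hle : B ≤ (integralClosure A (AddMonoidAlgebra ℂ G)).restrictScalars ℂ := by
      rw [hB]
      refine Algebra.adjoin_le ?_
      rintro _ ⟨s, ⟨n, hn, hs⟩, rfl⟩
      change IsIntegral A (AddMonoidAlgebra.single s (1 : ℂ))
      refine IsIntegral.of_pow hn ?_
      rw [AddMonoidAlgebra.single_pow, one_pow]
      have h1 : AddMonoidAlgebra.single (n • s) (1 : ℂ) ∈ A :=
        hA ▸ Algebra.subset_adjoin ⟨n • s, hs, rfl⟩
      exact isIntegral_algebraMap (R := A) (x := ⟨_, h1⟩)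
    exact fun hx => hle hx
  · intro hx
    rw [← AddMonoidAlgebra.sum_coeff_single x]
    refine B.sum_mem fun g hg => ?_
    have hs := aux_sat Q A hA g (aux_mono _ A hA g _ x rfl hx (Finsupp.mem_support_iff.1 hg))
    have h1 : AddMonoidAlgebra.single g (1 : ℂ) ∈ B := hB ▸ Algebra.subset_adjoin ⟨g, hs, rfl⟩
    have := B.smul_mem h1 (x.coeff g)
    simpa using this
end

section
/- Let Q be a finitely generated cancellative commutative monoid (written additively) that is sharp, i.e., a + b = 0 implies a = 0. Then: (a) the ℂ-linear map ε : ℂ[Q] → ℂ determined on basis elements by ε(χ^0) = 1 and ε(χ^q) = 0 for all q ≠ 0 is a ℂ-algebra homomorphism; (b) the kernel of ε is a maximal ideal of ℂ[Q]; and (c) every minimal prime ideal of ℂ[Q] is contained in ker ε (all irreducible components of V_Q = Spec ℂ[Q] pass through the torus-fixed point 0 defined by ε). -/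
theorem aux_hom {Q : Type*} [AddCommMonoid Q] [IsCancelAdd Q] [AddMonoid.FG Q]
    (hsharp : ∀ a b : Q, a + b = 0 → a = 0) :
    ∃ (n : ℕ) (h : Q →+ Lex (Fin n → ℤ)), ∀ q, h q = 0 → q = 0 := by
  let G := Algebra.GrothendieckAddGroup Q
  haveI : AddMonoid.FG G := inferInstance
  haveI : Module.Finite ℤ G := Module.Finite.iff_addGroup_fg.2 (AddGroup.fg_iff_addMonoid_fg.2 this)
  let T := G ⧸ Submodule.torsion ℤ G
  let b := Module.finBasis ℤ T
  let π : G →+ T := (Submodule.torsion ℤ G).mkQ.toAddMonoidHom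
  let e : T →+ (Fin (Module.finrank ℤ T) → ℤ) := b.equivFun.toLinearMap.toAddMonoidHom
  let l : (Fin (Module.finrank ℤ T) → ℤ) →+ Lex (Fin (Module.finrank ℤ T) → ℤ) :=
    { toFun := toLex, map_zero' := rfl, map_add' := fun _ _ => rfl }
  let i : Q →+ G := Algebra.GrothendieckAddGroup.of
  have hi : Function.Injective i := by
    intro x y hxy
    obtain ⟨c, hc⟩ := (AddLocalization.addMonoidOf (⊤ : AddSubmonoid Q)).eq_iff_exists.1 hxy
    exact add_left_cancel hc
  refine ⟨_, l.comp (e.comp (π.comp i)), fun q hq => ?_⟩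
  have h1 : b.equivFun (Submodule.Quotient.mk (i q)) = 0 := hq
  have h2 := (Submodule.Quotient.mk_eq_zero _).1 ((LinearEquiv.map_eq_zero_iff _).1 h1)
  obtain ⟨⟨a, ha⟩, h3⟩ := (Submodule.mem_torsion_iff _).1 h2
  have ha0 : a ≠ 0 := nonZeroDivisors.ne_zero ha
  have h3' : a • i q = 0 := h3
  have h4 : a.natAbs • i q = 0 := by
    rcases Int.natAbs_eq a with h | h
    · rw [h] at h3'; simpa using h3'
    · rw [h] at h3'; simpa using h3'
  rw [← map_nsmul] at h4
  have h5 : a.natAbs • q = 0 := hi (h4.trans (map_zero i).symm)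
  obtain ⟨m, hm⟩ := Nat.exists_eq_succ_of_ne_zero (Int.natAbs_ne_zero.2 ha0)
  rw [hm, Nat.succ_eq_add_one, add_nsmul, one_nsmul, add_comm] at h5
  exact hsharp _ _ h5


/-- For a finitely generated, cancellative, sharp commutative monoid `Q`:
(a) the ℂ-linear map `ε : ℂ[Q] → ℂ` sending `χ^0 ↦ 1` and `χ^q ↦ 0` for `q ≠ 0` is
a ℂ-algebra homomorphism; (b) its kernel is a maximal ideal; (c) every minimal
prime of `ℂ[Q]` is contained in `ker ε`. -/
theorem stmt_14 {Q : Type*} [AddCommMonoid Q] [IsCancelAdd Q] [AddMonoid.FG Q]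
    (hsharp : ∀ a b : Q, a + b = 0 → a = 0) :
    ∃ ε : AddMonoidAlgebra ℂ Q →ₐ[ℂ] ℂ,
      ε (AddMonoidAlgebra.single (0 : Q) (1 : ℂ)) = 1 ∧
      (∀ q : Q, q ≠ 0 → ε (AddMonoidAlgebra.single q (1 : ℂ)) = 0) ∧
      (RingHom.ker ε.toRingHom).IsMaximal ∧
      ∀ p ∈ minimalPrimes (AddMonoidAlgebra ℂ Q), p ≤ RingHom.ker ε.toRingHom := by
  classical
  let F : Multiplicative Q →* ℂ :=
    { toFun := fun q => if q.toAdd = 0 then 1 else 0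
      map_one' := by simp
      map_mul' := by
        intro x y
        by_cases hx : x.toAdd = 0
        · simp [hx]
        · have : x.toAdd + y.toAdd ≠ 0 := fun h => hx (hsharp _ _ h)
          simp [hx, this] }
  let ε : AddMonoidAlgebra ℂ Q →ₐ[ℂ] ℂ := AddMonoidAlgebra.lift ℂ ℂ Q F
  have hε : ∀ q c, ε (AddMonoidAlgebra.single q c) = if q = 0 then c else 0 := by
    intro q c
    simp [ε, F]
  refine ⟨ε, by simp [hε], fun q hq => by simp [hε, hq], ?_, ?_⟩
  · apply RingHom.ker_isMaximal_of_surjective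
    intro c
    exact ⟨AddMonoidAlgebra.single 0 c, by simpa using hε 0 c⟩
  · intro p hp f hf
    obtain ⟨n, h, hh⟩ := aux_hom hsharp
    let 𝒜 := AddMonoidAlgebra.gradeBy ℂ h
    have hpp : p.IsPrime := hp.1.1
    have hle := Ideal.toIdeal_homogeneousCore_le 𝒜 p
    have hcore : p ≤ (p.homogeneousCore 𝒜).toIdeal :=
      hp.2 ⟨Ideal.IsPrime.homogeneousCore hpp, bot_le⟩ hle
    have hmem := hle ((p.homogeneousCore 𝒜).isHomogeneous 0 (hcore hf))
    have key : ∀ f, ((DirectSum.decompose 𝒜 f 0 : 𝒜 0) : AddMonoidAlgebra ℂ Q)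
        = AddMonoidAlgebra.single 0 (ε f) := by
      intro f
      induction f using AddMonoidAlgebra.induction_linear with
      | zero => simp
      | add f g hf hg => simp [hf, hg, DirectSum.decompose_add]
      | single q c =>
        rw [hε, AddMonoidAlgebra.GradesBy.decompose_single]
        by_cases hq : q = 0
        · subst hq
          rw [DirectSum.coe_of_apply]
          simp
        · rw [DirectSum.coe_of_apply, if_neg (fun h0 => hq (hh q h0))]
          simp [hq]
    rw [key] at hmem
    change ε f = 0
    by_contra hne
    apply hpp.ne_top
    rw [Ideal.eq_top_iff_one]
    have := p.mul_mem_left (AddMonoidAlgebra.single 0 (ε f)⁻¹) hmem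
    rwa [AddMonoidAlgebra.single_mul_single, add_zero, inv_mul_cancel₀ hne,
      ← AddMonoidAlgebra.one_def] at this
end

section
/- Let a₁, a₂ ≥ 1 be integers and let d = gcd(a₁, a₂). Then the quotient ring ℂ[z₁, z₂]/(z₁^{a₁} − z₂^{a₂}) has exactly d minimal prime ideals (its spectrum has exactly d irreducible components), and every minimal prime ideal is contained in the maximal ideal generated by the images of z₁ and z₂ (all components meet at the origin). This follows from the factorization z₁^{a₁} − z₂^{a₂} = ∏_{ζ} (z₁^{a₁/d} − ζ·z₂^{a₂/d}), where ζ ranges over the d-th roots of unity in ℂ. -/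
open MvPolynomial

lemma aux_uv {A : Type*} [CommRing A] (u v : A) (p q : ℕ) (hp : 0 < p) (hpq : Nat.Coprime p q)
    (h : u ^ p = v ^ q) (a b i j : ℕ) (hia : i ≤ a) (e : q * a + p * b = q * i + p * j) :
    u ^ a * v ^ b = u ^ i * v ^ j := by
  obtain ⟨s, rfl⟩ := Nat.exists_eq_add_of_le hia
  have e2 : q * s + p * b = p * j := by nlinarith
  have hd : p ∣ q * s := by
    have : p ∣ q * s + p * b := e2 ▸ dvd_mul_right p j
    exact (Nat.dvd_add_left (dvd_mul_right p b)).1 this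
  obtain ⟨k, rfl⟩ := hpq.dvd_of_dvd_mul_left hd
  have : j = q * k + b := by
    apply Nat.eq_of_mul_eq_mul_left hp
    rw [← e2]; ring
  subst this
  rw [pow_add, pow_add, pow_mul, pow_mul, h]; ring

noncomputable def phi (p q : ℕ) (c : ℂ) : MvPolynomial (Fin 2) ℂ →ₐ[ℂ] Polynomial ℂ :=
  aeval ![Polynomial.C c * Polynomial.X ^ q, Polynomial.X ^ p]

lemma phi_f (p q : ℕ) (c z : ℂ) : phi p q c (X 0 ^ p - C z * X 1 ^ q) =
    Polynomial.C (c ^ p - z) * Polynomial.X ^ (p * q) := by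
  simp [phi, MvPolynomial.algHom_C]
  ring

lemma ker_phi (p q : ℕ) (hp : 0 < p) (hpq : Nat.Coprime p q) (c : ℂ) (hc : c ≠ 0) :
    RingHom.ker (phi p q c) = Ideal.span {X 0 ^ p - C (c ^ p) * X 1 ^ q} := by
  apply le_antisymm
  · set J := Ideal.span {(X 0 ^ p - C (c ^ p) * X 1 ^ q : MvPolynomial (Fin 2) ℂ)} with hJ
    let u : MvPolynomial (Fin 2) ℂ ⧸ J := Ideal.Quotient.mk J (C c⁻¹ * X 0)
    let v : MvPolynomial (Fin 2) ℂ ⧸ J := Ideal.Quotient.mk J (X 1)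
    have huv : u ^ p = v ^ q := by
      simp only [u, v, ← map_pow]
      rw [Ideal.Quotient.eq, hJ, Ideal.mem_span_singleton]
      refine ⟨C (c⁻¹ ^ p), ?_⟩
      have : (C (c ^ p) * C (c⁻¹ ^ p) : MvPolynomial (Fin 2) ℂ) = 1 := by
        rw [← C_mul, ← mul_pow, mul_inv_cancel₀ hc]; simp
      rw [mul_pow, ← C_pow]
      linear_combination (X 1 ^ q) * this
    have key : ∀ a b i j : ℕ, q * a + p * b = q * i + p * j →
        u ^ a * v ^ b = u ^ i * v ^ j := by
      intro a b i j e
      rcases le_total i a with h | h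
      · exact aux_uv u v p q hp hpq huv a b i j h e
      · exact (aux_uv u v p q hp hpq huv i j a b h e.symm).symm
    classical
    let s : ℕ → MvPolynomial (Fin 2) ℂ ⧸ J := fun n =>
      if h : ∃ ij : ℕ × ℕ, n = q * ij.1 + p * ij.2 then
        u ^ h.choose.1 * v ^ h.choose.2 else 0
    have hs : ∀ a b, s (q * a + p * b) = u ^ a * v ^ b := by
      intro a b
      have h : ∃ ij : ℕ × ℕ, q * a + p * b = q * ij.1 + p * ij.2 := ⟨(a, b), rfl⟩
      simp only [s, dif_pos h]
      exact (key _ _ _ _ h.choose_spec).symm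
    let σ : Polynomial ℂ →ₗ[ℂ] MvPolynomial (Fin 2) ℂ ⧸ J :=
      (Polynomial.basisMonomials ℂ).constr ℂ s
    have hσ : ∀ n, σ (Polynomial.X ^ n) = s n := by
      intro n
      have := (Polynomial.basisMonomials ℂ).constr_basis ℂ s n
      simpa [Polynomial.coe_basisMonomials, Polynomial.X_pow_eq_monomial] using this
    have hcomp : σ ∘ₗ (phi p q c).toLinearMap = (Ideal.Quotient.mkₐ ℂ J).toLinearMap := by
      apply MvPolynomial.basisMonomials (Fin 2) ℂ |>.ext
      intro m
      have hm : (monomial m (1:ℂ)) = X 0 ^ m 0 * X 1 ^ m 1 := by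
        rw [monomial_eq, Finsupp.prod_fintype _ _ (by simp)]
        simp
      simp only [coe_basisMonomials, LinearMap.comp_apply, AlgHom.toLinearMap_apply, hm]
      have : phi p q c (X 0 ^ m 0 * X 1 ^ m 1) =
          (c ^ m 0) • Polynomial.X ^ (q * m 0 + p * m 1) := by
        simp [phi, Polynomial.smul_eq_C_mul]; ring
      rw [this, map_smul, hσ, hs]
      have h2 : ((c ^ m 0) • (u ^ m 0 * v ^ m 1)) =
        Ideal.Quotient.mkₐ ℂ J ((c ^ m 0) • ((C c⁻¹ * X 0) ^ m 0 * X 1 ^ m 1)) := by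
        rw [map_smul]; simp [u, v]
      rw [h2]
      congr 1
      rw [smul_eq_C_mul, mul_pow, ← C_pow, ← mul_assoc, ← mul_assoc, ← C_mul, ← mul_pow,
        mul_inv_cancel₀ hc]
      simp
    intro g hg
    rw [RingHom.mem_ker] at hg
    have := LinearMap.congr_fun hcomp g
    simp only [LinearMap.comp_apply, AlgHom.toLinearMap_apply] at this
    rw [hg, map_zero] at this
    exact Ideal.Quotient.eq_zero_iff_mem.1 this.symm
  · rw [Ideal.span_singleton_le_iff_mem, RingHom.mem_ker, phi_f]
    simp

lemma f_prime (p q : ℕ) (hp : 0 < p) (hpq : Nat.Coprime p q) (z : ℂ) (hz : z ≠ 0) :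
    (Ideal.span {(X 0 ^ p - C z * X 1 ^ q : MvPolynomial (Fin 2) ℂ)}).IsPrime := by
  obtain ⟨c, hc⟩ := IsAlgClosed.exists_pow_nat_eq z hp
  subst hc
  rw [← ker_phi p q hp hpq c (fun h => hz (by rw [h, zero_pow hp.ne']))]
  exact RingHom.ker_isPrime _

lemma f_inj (p q : ℕ) (hp : 0 < p) (z w : ℂ)
    (h : (X 0 ^ p - C w * X 1 ^ q : MvPolynomial (Fin 2) ℂ) ∈
      Ideal.span {(X 0 ^ p - C z * X 1 ^ q : MvPolynomial (Fin 2) ℂ)}) : w = z := by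
  obtain ⟨c, hc⟩ := IsAlgClosed.exists_pow_nat_eq z hp
  obtain ⟨g, hg⟩ := Ideal.mem_span_singleton.1 h
  have := congrArg (phi p q c) hg
  rw [map_mul, phi_f, phi_f, hc] at this
  simp [sub_eq_zero] at this
  exact this.symm

lemma minPr (p q d : ℕ) (hp : 0 < p) (hd : 0 < d) (hpq : Nat.Coprime p q) :
    (Ideal.span {(X 0 ^ (p * d) - X 1 ^ (q * d) : MvPolynomial (Fin 2) ℂ)}).minimalPrimes =
    (fun z : ℂ => Ideal.span {(X 0 ^ p - C z * X 1 ^ q : MvPolynomial (Fin 2) ℂ)}) ''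
      (Polynomial.nthRootsFinset d (1 : ℂ) : Set ℂ) := by
  have hprime : ∀ z : ℂ, z ^ d = 1 →
      (Ideal.span {(X 0 ^ p - C z * X 1 ^ q : MvPolynomial (Fin 2) ℂ)}).IsPrime := by
    intro z hz
    refine f_prime p q hp hpq z ?_
    rintro rfl
    simp [hd.ne'] at hz
  have hle : ∀ z : ℂ, z ^ d = 1 →
      (Ideal.span {(X 0 ^ (p * d) - X 1 ^ (q * d) : MvPolynomial (Fin 2) ℂ)}) ≤
      (Ideal.span {(X 0 ^ p - C z * X 1 ^ q : MvPolynomial (Fin 2) ℂ)}) := by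
    intro z hz
    rw [Ideal.span_singleton_le_span_singleton]
    have := sub_dvd_pow_sub_pow (X 0 ^ p : MvPolynomial (Fin 2) ℂ) (C z * X 1 ^ q) d
    rwa [mul_pow, ← C_pow, hz, C_1, one_mul, ← pow_mul, ← pow_mul] at this
  have hex : ∀ Q : Ideal (MvPolynomial (Fin 2) ℂ), Q.IsPrime →
      (Ideal.span {(X 0 ^ (p * d) - X 1 ^ (q * d) : MvPolynomial (Fin 2) ℂ)}) ≤ Q →
      ∃ z : ℂ, z ^ d = 1 ∧ Ideal.span {(X 0 ^ p - C z * X 1 ^ q : MvPolynomial (Fin 2) ℂ)} ≤ Q := by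
    intro Q hQ hl
    rw [Ideal.span_singleton_le_iff_mem] at hl
    have hz := Complex.isPrimitiveRoot_exp d hd.ne'
    have hzC := hz.map_of_injective (C_injective (Fin 2) ℂ)
    rw [pow_mul, pow_mul, hzC.pow_sub_pow_eq_prod_sub_mul _ _ hd] at hl
    obtain ⟨η, hη, hm⟩ := (hQ.prod_mem_iff).1 hl
    rw [Polynomial.mem_nthRootsFinset hd] at hη
    have : NeZero d := ⟨hd.ne'⟩
    obtain ⟨i, -, rfl⟩ := hzC.eq_pow_of_pow_eq_one hη
    refine ⟨Complex.exp (2 * Real.pi * Complex.I / d) ^ i, ?_, ?_⟩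
    rotate_left
    · rw [Ideal.span_singleton_le_iff_mem, C_pow]; exact hm
    · rw [← pow_mul, mul_comm i d, pow_mul, hz.pow_eq_one, one_pow]
  ext Q
  simp only [Set.mem_image, Finset.mem_coe, Polynomial.mem_nthRootsFinset hd]
  constructor
  · intro hQ
    obtain ⟨z, hz, hl⟩ := hex Q hQ.1.1 hQ.1.2
    exact ⟨z, hz, le_antisymm hl (hQ.2 ⟨hprime z hz, hle z hz⟩ hl)⟩
  · rintro ⟨z, hz, rfl⟩
    refine ⟨⟨hprime z hz, hle z hz⟩, ?_⟩
    intro Q hQ hl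
    obtain ⟨w, hw, hl2⟩ := hex Q hQ.1 hQ.2
    have := f_inj p q hp z w ((Ideal.span_singleton_le_iff_mem _).1 (hl2.trans hl))
    subst this
    exact hl2

lemma M_eq : (Ideal.span {X 0, X 1} : Ideal (MvPolynomial (Fin 2) ℂ)) =
    RingHom.ker (constantCoeff : MvPolynomial (Fin 2) ℂ →+* ℂ) := by
  have e : ({X 0, X 1} : Set (MvPolynomial (Fin 2) ℂ)) = X '' Set.univ := by
    ext x; simp [eq_comm]
  ext x
  rw [e, mem_ideal_span_X_image, RingHom.mem_ker, constantCoeff_eq]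
  constructor
  · intro h
    by_contra h0
    obtain ⟨i, -, hi⟩ := h 0 (mem_support_iff.2 h0)
    simp at hi
  · intro h m hm
    by_contra! hcon
    have : m = 0 := by ext i; simpa using hcon i (Set.mem_univ i)
    subst this
    exact (mem_support_iff.1 hm) h

/-- The ring `ℂ[z₁,z₂]/(z₁^{a₁} - z₂^{a₂})` has exactly `gcd(a₁,a₂)` minimal primes,
the ideal generated by the images of `z₁` and `z₂` is maximal, and every minimal
prime is contained in it (all irreducible components meet at the origin). -/
theorem stmt_15 (a₁ a₂ : ℕ) (h₁ : 1 ≤ a₁) (h₂ : 1 ≤ a₂)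
    (I : Ideal (MvPolynomial (Fin 2) ℂ))
    (hI : I = Ideal.span {MvPolynomial.X 0 ^ a₁ - MvPolynomial.X 1 ^ a₂})
    (m : Ideal (MvPolynomial (Fin 2) ℂ ⧸ I))
    (hm : m = Ideal.span {Ideal.Quotient.mk I (MvPolynomial.X 0),
      Ideal.Quotient.mk I (MvPolynomial.X 1)}) :
    (minimalPrimes (MvPolynomial (Fin 2) ℂ ⧸ I)).Finite ∧
    Nat.card (minimalPrimes (MvPolynomial (Fin 2) ℂ ⧸ I)) = Nat.gcd a₁ a₂ ∧
    m.IsMaximal ∧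
    ∀ p ∈ minimalPrimes (MvPolynomial (Fin 2) ℂ ⧸ I), p ≤ m := by
  have hd : 0 < Nat.gcd a₁ a₂ := Nat.gcd_pos_of_pos_left _ h₁
  obtain ⟨p, q, hpq, e1, e2⟩ := Nat.exists_coprime a₁ a₂
  set d := Nat.gcd a₁ a₂ with hdd
  have hp : 0 < p := Nat.pos_of_ne_zero (by rintro rfl; omega)
  have hq : 0 < q := Nat.pos_of_ne_zero (by rintro rfl; omega)
  have hmin := minPr p q d hp hd hpq
  rw [← e1, ← e2, ← hI] at hmin
  have hcm := Ideal.minimalPrimes_eq_comap (I := I)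
  have hsurj : Function.Surjective (Ideal.Quotient.mk I) := Ideal.Quotient.mk_surjective
  have hinj := Ideal.comap_injective_of_surjective _ hsurj
  have hfin : I.minimalPrimes.Finite := by rw [hmin]; exact (Finset.finite_toSet _).image _
  have hcard : Nat.card I.minimalPrimes = d := by
    rw [hmin, Nat.card_image_of_injOn]
    · rw [Nat.card_coe_set_eq, Set.ncard_coe_finset]
      exact (Complex.isPrimitiveRoot_exp d hd.ne').card_nthRootsFinset
    · intro z _ w _ h
      refine f_inj p q hp w z ?_
      simp only at h
      rw [← h]
      exact Ideal.mem_span_singleton_self _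
  have hmM : m = Ideal.map (Ideal.Quotient.mk I) (Ideal.span {X 0, X 1}) := by
    rw [hm, Ideal.map_span, Set.image_pair]
  have hIM : I ≤ Ideal.span {X 0, X 1} := by
    rw [hI, M_eq, Ideal.span_singleton_le_iff_mem, RingHom.mem_ker]
    simp [show a₁ ≠ 0 by omega, show a₂ ≠ 0 by omega]
  have hMmax : (Ideal.span {X 0, X 1} : Ideal (MvPolynomial (Fin 2) ℂ)).IsMaximal := by
    rw [M_eq]
    exact RingHom.ker_isMaximal_of_surjective _ (fun z => ⟨C z, by simp⟩)
  refine ⟨?_, ?_, ?_, ?_⟩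
  · rw [hcm] at hfin
    exact Set.Finite.of_finite_image hfin hinj.injOn
  · rw [hcm, Nat.card_image_of_injective hinj] at hcard
    exact hcard
  · rw [hmM]
    refine (Ideal.map_eq_top_or_isMaximal_of_surjective _ hsurj hMmax).resolve_left ?_
    intro ht
    have := Ideal.comap_map_of_surjective _ hsurj (Ideal.span {X 0, X 1})
    rw [ht, ← RingHom.ker_eq_comap_bot, Ideal.mk_ker, sup_eq_left.2 hIM, Ideal.comap_top] at this
    exact hMmax.ne_top this.symm
  · intro P hP
    have h1 : Ideal.comap (Ideal.Quotient.mk I) P ∈ I.minimalPrimes := by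
      rw [hcm]; exact ⟨P, hP, rfl⟩
    rw [hmin] at h1
    obtain ⟨z, -, hz⟩ := h1
    rw [← Ideal.map_comap_of_surjective _ hsurj P, ← hz, hmM]
    apply Ideal.map_mono
    rw [M_eq, Ideal.span_singleton_le_iff_mem, RingHom.mem_ker]
    simp [hp.ne', hq.ne']
end

section
/- Let Q be a finitely generated cancellative commutative monoid (written additively) and let S be a finite subset of Q that generates Q as a monoid. Then the following are equivalent: (1) Q is sharp (a + b = 0 implies a = 0) and every element of S is nonzero; (2) there exists a monoid homomorphism φ : Q → ℕ with φ(s) > 0 for every s ∈ S; (3) there exist a sharp commutative monoid P and a monoid homomorphism φ : Q → P with φ(s) ≠ 0 for every s ∈ S. -/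
universe u

lemma clear_den {ι : Type*} [DecidableEq ι] (S : Finset ι) (c : ι → ℚ) (hc : ∀ i ∈ S, 0 ≤ c i) :
    ∃ N : ℕ, 0 < N ∧ ∀ i ∈ S, ∃ k : ℕ, (N : ℚ) * c i = k := by
  induction S using Finset.induction_on with
  | empty => exact ⟨1, one_pos, by simp⟩
  | insert a s ha ih =>
    obtain ⟨N, hN, h⟩ := ih (fun i hi => hc i (Finset.mem_insert_of_mem hi))
    refine ⟨(c a).den * N, Nat.mul_pos (c a).den_pos hN, fun i hi => ?_⟩
    rcases Finset.mem_insert.1 hi with rfl | hi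
    · have h0 : 0 ≤ (c i).num := Rat.num_nonneg.2 (hc i (Finset.mem_insert_self _ _))
      refine ⟨N * (c i).num.toNat, ?_⟩
      have h1 : (((c i).num.toNat : ℕ) : ℚ) = ((c i).num : ℚ) := by
        exact_mod_cast congrArg (Int.cast : ℤ → ℚ) (Int.toNat_of_nonneg h0)
      push_cast
      rw [h1, ← Rat.den_mul_eq_num (c i)]
      ring
    · obtain ⟨k, hk⟩ := h i hi
      refine ⟨(c a).den * k, ?_⟩
      push_cast
      rw [mul_assoc, hk]

lemma small_eps {ι : Type*} [DecidableEq ι] (S : Finset ι) (a b : ι → ℚ) (ha : ∀ i ∈ S, 0 < a i) :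
    ∃ e : ℚ, 0 < e ∧ ∀ i ∈ S, 0 < a i - e * b i := by
  induction S using Finset.induction_on with
  | empty => exact ⟨1, one_pos, by simp⟩
  | insert j s hj ih =>
    obtain ⟨e, he, h⟩ := ih (fun i hi => ha i (Finset.mem_insert_of_mem hi))
    have hj := ha j (Finset.mem_insert_self _ _)
    have hd : 0 < |b j| + 1 := by positivity
    refine ⟨min e (a j / (|b j| + 1)), lt_min he (by positivity), fun i hi => ?_⟩
    have hp : 0 < min e (a j / (|b j| + 1)) := lt_min he (by positivity)
    have h1 := min_le_left e (a j / (|b j| + 1))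
    have h2 := min_le_right e (a j / (|b j| + 1))
    generalize min e (a j / (|b j| + 1)) = m at *
    rcases Finset.mem_insert.1 hi with rfl | hi
    · rw [le_div_iff₀ hd] at h2
      nlinarith [le_abs_self (b i)]
    · have h3 := h i hi
      have h4 := ha i (Finset.mem_insert_of_mem hi)
      rcases le_total 0 (b i) with hb | hb <;> nlinarith

lemma gordan {ι : Type*} [DecidableEq ι] {V : Type*} [AddCommGroup V] [Module ℚ V] (S : Finset ι) :
    ∀ v : ι → V, (∀ c : ι → ℚ, (∀ i ∈ S, 0 ≤ c i) → ∑ i ∈ S, c i • v i = 0 → ∀ i ∈ S, c i = 0) →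
    ∃ f : V →ₗ[ℚ] ℚ, ∀ i ∈ S, 0 < f (v i) := by
  induction S using Finset.induction_on with
  | empty => exact fun v _ => ⟨0, by simp⟩
  | insert j s hj ih =>
    intro v hv
    have key : ∀ (c : ι → ℚ) (d : ℚ), (∀ i ∈ s, 0 ≤ c i) → 0 ≤ d →
        d • v j + ∑ i ∈ s, c i • v i = 0 → d = 0 ∧ ∀ i ∈ s, c i = 0 := by
      intro c d hc hd h
      have hne : ∀ i ∈ s, i ≠ j := fun i hi h => hj (h ▸ hi)
      have := hv (Function.update c j d) (by
        intro i hi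
        rcases Finset.mem_insert.1 hi with rfl | hi
        · simpa
        · simpa [hne i hi] using hc i hi) (by
        rw [Finset.sum_insert hj, Function.update_self, ← h]
        congr 1
        refine Finset.sum_congr rfl fun i hi => ?_
        rw [Function.update_of_ne (hne i hi)])
      refine ⟨by simpa using this j (Finset.mem_insert_self _ _), fun i hi => ?_⟩
      simpa [hne i hi] using this i (Finset.mem_insert_of_mem hi)
    obtain ⟨f, hf⟩ := ih v (fun c hc h => (key c 0 hc le_rfl (by simpa using h)).2)
    rcases lt_trichotomy (f (v j)) 0 with h | h | h
    · obtain ⟨g, hg⟩ := ih (fun i => v i + (f (v i) / (-f (v j))) • v j) (by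
        intro c hc h0
        refine (key c (∑ i ∈ s, c i * (f (v i) / (-f (v j)))) hc
          (Finset.sum_nonneg fun i hi => mul_nonneg (hc i hi)
            (div_nonneg (hf i hi).le (by linarith))) ?_).2
        rw [← h0, Finset.sum_smul, ← Finset.sum_add_distrib]
        refine Finset.sum_congr rfl fun i hi => ?_
        rw [smul_add, smul_smul, add_comm])
      obtain ⟨e, he, hE⟩ := small_eps s _ (fun i => f (v i) / (-f (v j))) hg
      have hn : f (v j) ≠ 0 := h.ne
      refine ⟨g + ((e - g (v j)) / f (v j)) • f, fun i hi => ?_⟩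
      rcases Finset.mem_insert.1 hi with rfl | hi
      · simp only [LinearMap.add_apply, LinearMap.smul_apply, smul_eq_mul]
        rw [div_mul_cancel₀ _ hn]; linarith
      · have := hE i hi
        simp only [LinearMap.add_apply, LinearMap.smul_apply, smul_eq_mul, map_add, map_smul] at this ⊢
        convert this using 1
        field_simp
        ring
    · have hv0 : v j ≠ 0 := by
        intro h0
        have := (key 0 1 (by simp) zero_le_one (by simp [h0])).1
        exact one_ne_zero this
      obtain ⟨g, hg⟩ : ∃ g : V →ₗ[ℚ] ℚ, 0 < g (v j) := by
        obtain ⟨g, hg⟩ : ∃ g : Module.Dual ℚ V, g (v j) ≠ 0 := by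
          by_contra! hh
          exact hv0 ((Module.forall_dual_apply_eq_zero_iff ℚ _).1 hh)
        rcases lt_or_gt_of_ne hg with h | h
        · exact ⟨-g, by simpa using h⟩
        · exact ⟨g, h⟩
      obtain ⟨e, he, hE⟩ := small_eps s _ (fun i => - g (v i)) hf
      refine ⟨f + e • g, fun i hi => ?_⟩
      simp only [LinearMap.add_apply, LinearMap.smul_apply, smul_eq_mul]
      rcases Finset.mem_insert.1 hi with rfl | hi
      · rw [h]; simpa using mul_pos he hg
      · linarith [hE i hi]
    · refine ⟨f, fun i hi => ?_⟩
      rcases Finset.mem_insert.1 hi with rfl | hi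
      · exact h
      · exact hf i hi

lemma three_one {Q : Type*} [AddCommMonoid Q] {P : Type*} [AddCommMonoid P]
    (S : Finset Q) (hgen : AddSubmonoid.closure (S : Set Q) = ⊤)
    (hP : ∀ a b : P, a + b = 0 → a = 0) (φ : Q →+ P) (hφ : ∀ s ∈ S, φ s ≠ 0) :
    (∀ a b : Q, a + b = 0 → a = 0) ∧ ∀ s ∈ S, s ≠ 0 := by
  have key : ∀ a : Q, φ a = 0 → a = 0 := by
    intro a
    have ha : a ∈ AddSubmonoid.closure (S : Set Q) := by rw [hgen]; trivial
    induction ha using AddSubmonoid.closure_induction with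
    | mem x hx => exact fun h => absurd h (hφ x hx)
    | zero => exact fun _ => rfl
    | add x y _ _ hx hy =>
      intro h
      rw [map_add] at h
      rw [hx (hP _ _ h), hy (hP _ _ (by rwa [add_comm] at h)), add_zero]
  refine ⟨fun a b h => key a (hP _ (φ b) ?_), fun s hs h => hφ s hs (by rw [h, map_zero])⟩
  rw [← map_add, h, map_zero]

lemma sum_zero {Q : Type*} [AddCommMonoid Q] {ι : Type*} (hQ : ∀ a b : Q, a + b = 0 → a = 0)
    (S : Finset ι) (x : ι → Q) (h : ∑ i ∈ S, x i = 0) : ∀ i ∈ S, x i = 0 := by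
  classical
  intro i hi
  rw [← Finset.add_sum_erase S x hi] at h
  exact hQ _ _ h

lemma sharp_nsmul_cancel {Q : Type*} [AddCommMonoid Q] (hQ : ∀ a b : Q, a + b = 0 → a = 0)
    (n : ℕ) (hn : n ≠ 0) (x : Q) (h : n • x = 0) : x = 0 := by
  obtain ⟨k, rfl⟩ := Nat.exists_eq_succ_of_ne_zero hn
  rw [succ_nsmul, add_comm] at h
  exact hQ _ _ h

open TensorProduct in
lemma one_two {Q : Type*} [AddCommMonoid Q] [IsCancelAdd Q]
    (S : Finset Q) (hgen : AddSubmonoid.closure (S : Set Q) = ⊤)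
    (hQ : ∀ a b : Q, a + b = 0 → a = 0) (hS : ∀ s ∈ S, s ≠ 0) :
    ∃ φ : Q →+ ℕ, ∀ s ∈ S, 0 < φ s := by
  classical
  let G := Algebra.GrothendieckAddGroup Q
  let j : Q →+ G := Algebra.GrothendieckAddGroup.of
  have hj : Function.Injective j := Algebra.GrothendieckAddGroup.of_injective
  let t : G →ₗ[ℤ] ℚ ⊗[ℤ] G := TensorProduct.mk ℤ ℚ G 1
  have hloc : IsLocalizedModule (nonZeroDivisors ℤ) t :=
    IsLocalization.tensorProduct_isLocalizedModule _ _
  have ht : ∀ q : Q, t (j q) = 0 → q = 0 := by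
    intro q h
    obtain ⟨⟨m, hm⟩, h⟩ := (IsLocalizedModule.eq_zero_iff (nonZeroDivisors ℤ) t).1 h
    have hm0 : m ≠ 0 := nonZeroDivisors.ne_zero hm
    have h' : m • j q = 0 := h
    have h2 : m.natAbs • j q = 0 := by
      rcases Int.natAbs_eq m with hh | hh
      · rw [hh, natCast_zsmul] at h'; exact h'
      · rw [hh, neg_smul, neg_eq_zero, natCast_zsmul] at h'; exact h'
    rw [← map_nsmul] at h2
    exact sharp_nsmul_cancel hQ _ (Int.natAbs_ne_zero.2 hm0) _ (hj (by rw [h2, map_zero]))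
  let T : Q →+ ℚ ⊗[ℤ] G := t.toAddMonoidHom.comp j
  obtain ⟨f, hf⟩ := gordan S (fun q => T q) (by
    intro c hc h
    obtain ⟨N, hN, hk⟩ := clear_den S c hc
    choose! k hk using hk
    have h1 : T (∑ i ∈ S, k i • i) = 0 := by
      have := congrArg (fun x => (N : ℚ) • x) h
      simp only [smul_zero, Finset.smul_sum, smul_smul] at this
      rw [← this, map_sum]
      refine Finset.sum_congr rfl fun i hi => ?_
      rw [hk i hi, map_nsmul, Nat.cast_smul_eq_nsmul]
    have h2 := sum_zero hQ _ _ (ht _ h1)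
    intro i hi
    have h3 : k i = 0 := by
      by_contra h0
      exact hS i hi (sharp_nsmul_cancel hQ _ h0 _ (h2 i hi))
    have h4 := hk i hi
    rw [h3, Nat.cast_zero] at h4
    have : (N : ℚ) ≠ 0 := by exact_mod_cast hN.ne'
    exact (mul_eq_zero.1 h4).resolve_left this)
  obtain ⟨N, hN, hk⟩ := clear_den S (fun q => f (T q)) (fun i hi => (hf i hi).le)
  have hall : ∀ q : Q, ∃ n : ℕ, (N : ℚ) * f (T q) = n := by
    intro q
    have hq : q ∈ AddSubmonoid.closure (S : Set Q) := by rw [hgen]; trivial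
    induction hq using AddSubmonoid.closure_induction with
    | mem x hx => exact hk x hx
    | zero => exact ⟨0, by simp⟩
    | add x y _ _ hx hy =>
      obtain ⟨a, ha⟩ := hx
      obtain ⟨b, hb⟩ := hy
      exact ⟨a + b, by rw [map_add, map_add, mul_add, ha, hb, Nat.cast_add]⟩
  choose p hp using hall
  refine ⟨⟨⟨p, ?_⟩, ?_⟩, ?_⟩
  · have := hp 0
    simp only [map_zero, mul_zero] at this
    exact_mod_cast this.symm
  · intro x y
    have := hp (x + y)
    rw [map_add, map_add, mul_add, hp, hp] at this
    exact_mod_cast this.symm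
  · intro s hs
    have h1 : (0 : ℚ) < N * f (T s) := mul_pos (by exact_mod_cast hN) (hf s hs)
    rw [hp] at h1
    exact_mod_cast h1

/-- For a finitely generated cancellative commutative monoid `Q` with finite
generating set `S`, the following are equivalent: (1) `Q` is sharp and every
element of `S` is nonzero; (2) there is a monoid homomorphism `Q → ℕ` positive on
`S`; (3) there is a monoid homomorphism to a sharp commutative monoid which is
nonzero on `S`. -/
theorem stmt_16 {Q : Type u} [AddCommMonoid Q] [IsCancelAdd Q]
    (S : Finset Q) (hgen : AddSubmonoid.closure (S : Set Q) = ⊤) :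
    (((∀ a b : Q, a + b = 0 → a = 0) ∧ ∀ s ∈ S, s ≠ 0) ↔
      ∃ φ : Q →+ ℕ, ∀ s ∈ S, 0 < φ s) ∧
    ((∃ φ : Q →+ ℕ, ∀ s ∈ S, 0 < φ s) ↔
      ∃ (P : Type u) (_ : AddCommMonoid P),
        (∀ a b : P, a + b = 0 → a = 0) ∧ ∃ φ : Q →+ P, ∀ s ∈ S, φ s ≠ 0) := by
  have h12 : ((∀ a b : Q, a + b = 0 → a = 0) ∧ ∀ s ∈ S, s ≠ 0) →
      ∃ φ : Q →+ ℕ, ∀ s ∈ S, 0 < φ s := fun h => one_two S hgen h.1 h.2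
  refine ⟨⟨h12, ?_⟩, ⟨?_, ?_⟩⟩
  · rintro ⟨φ, hφ⟩
    exact three_one S hgen (fun a b h => by omega) φ (fun s hs => (hφ s hs).ne')
  · rintro ⟨φ, hφ⟩
    refine ⟨ULift.{u} ℕ, inferInstance, ?_,
      (AddEquiv.ulift.symm : ℕ ≃+ ULift.{u} ℕ).toAddMonoidHom.comp φ, ?_⟩
    · intro a b h
      have h' : a.down + b.down = 0 := congrArg ULift.down h
      exact ULift.down_injective (show a.down = 0 by omega)
    · intro s hs h
      exact (hφ s hs).ne' (congrArg ULift.down h)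
  · rintro ⟨P, _, hP, φ, hφ⟩
    exact h12 (three_one S hgen hP φ hφ)
end

section
/- Let M and N be finitely generated free ℤ-modules and ρ : M → N a ℤ-linear map, with dual map ρ^∨ : Hom(N, ℤ) → Hom(M, ℤ) given by precomposition with ρ. Let (ker ρ)^⊥ := {φ ∈ Hom(M, ℤ) : φ(x) = 0 for all x ∈ ker ρ} denote the annihilator of the kernel of ρ. Then: (a) the image of ρ^∨ is contained in (ker ρ)^⊥; and (b) for φ ∈ Hom(M, ℤ), one has φ ∈ (ker ρ)^⊥ if and only if there exists an integer k ≥ 1 with k•φ ∈ image(ρ^∨). Consequently the quotient Hom(M,ℤ)/(ker ρ)^⊥ is torsion-free, and (ker ρ)^⊥/image(ρ^∨) equals the torsion subgroup of Hom(M, ℤ)/image(ρ^∨). -/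
theorem aux_ext {R M N : Type*} [CommRing R] [IsDomain R] [IsPrincipalIdealRing R] [AddCommGroup M] [AddCommGroup N]
    [Module R M] [Module R N] [Module.Free R N] [Module.Finite R N]
    (ρ : M →ₗ[R] N) (φ : Module.Dual R M) (h : ∀ x, ρ x = 0 → φ x = 0) :
    ∃ k : R, k ≠ 0 ∧ ∃ ψ : Module.Dual R N, ∀ x, ψ (ρ x) = k * φ x := by
  classical
  obtain ⟨r, S⟩ := Submodule.smithNormalForm (Module.Free.chooseBasis R N) (LinearMap.range ρ)
  have ha : ∀ i, S.a i ≠ 0 := by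
    intro i h0
    have h1 := S.snf i
    rw [h0, zero_smul] at h1
    exact S.bN.ne_zero i (Subtype.ext h1)
  let φ' : LinearMap.range ρ →ₗ[R] R :=
    ((LinearMap.ker ρ).liftQ φ (fun x hx => h x hx)) ∘ₗ ρ.quotKerEquivRange.symm.toLinearMap
  have hφ' : ∀ x, φ' (ρ.rangeRestrict x) = φ x := by
    intro x
    have : ρ.quotKerEquivRange.symm (ρ.rangeRestrict x) = (LinearMap.ker ρ).mkQ x := by
      rw [LinearEquiv.symm_apply_eq]; rfl
    simp only [φ', LinearMap.comp_apply, LinearEquiv.coe_coe, this]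
    rfl
  let ψ : N →ₗ[R] R := S.bM.constr R
    (fun j => ∑ i, if S.f i = j then (∏ l ∈ Finset.univ.erase i, S.a l) * φ' (S.bN i) else 0)
  refine ⟨∏ i, S.a i, Finset.prod_ne_zero_iff.2 (fun i _ => ha i), ψ, ?_⟩
  have key : ψ ∘ₗ (LinearMap.range ρ).subtype = (∏ i, S.a i) • φ' := by
    refine S.bN.ext fun i => ?_
    have h2 : ψ (S.bM (S.f i)) = (∏ l ∈ Finset.univ.erase i, S.a l) * φ' (S.bN i) := by
      simp [ψ, Module.Basis.constr_basis]
    simp only [LinearMap.comp_apply, Submodule.subtype_apply, S.snf i, map_smul, h2,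
      LinearMap.smul_apply, smul_eq_mul]
    rw [← mul_assoc, Finset.mul_prod_erase _ _ (Finset.mem_univ i)]
  intro x
  have := LinearMap.congr_fun key (ρ.rangeRestrict x)
  simpa [hφ'] using this

/-- For a ℤ-linear map `ρ : M → N` between finitely generated free ℤ-modules, with
dual map `ρ^∨` and annihilator `(ker ρ)^⊥ ⊆ Hom(M,ℤ)`:
(a) `image ρ^∨ ⊆ (ker ρ)^⊥`;
(b) `φ ∈ (ker ρ)^⊥` iff some positive multiple of `φ` lies in `image ρ^∨`;
consequently `Hom(M,ℤ)/(ker ρ)^⊥` is torsion-free and `(ker ρ)^⊥/image ρ^∨` is the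
torsion subgroup of `Hom(M,ℤ)/image ρ^∨`. -/
theorem stmt_17 {M N : Type*} [AddCommGroup M] [AddCommGroup N]
    [Module ℤ M] [Module ℤ N] [Module.Free ℤ M] [Module.Free ℤ N]
    [Module.Finite ℤ M] [Module.Finite ℤ N]
    (ρ : M →ₗ[ℤ] N) :
    LinearMap.range ρ.dualMap ≤ (LinearMap.ker ρ).dualAnnihilator ∧
    (∀ φ : Module.Dual ℤ M, φ ∈ (LinearMap.ker ρ).dualAnnihilator ↔
      ∃ k : ℕ, 1 ≤ k ∧ k • φ ∈ LinearMap.range ρ.dualMap) ∧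
    (∀ x : Module.Dual ℤ M ⧸ (LinearMap.ker ρ).dualAnnihilator,
      (∃ k : ℕ, 1 ≤ k ∧ k • x = 0) → x = 0) ∧
    (LinearMap.ker ρ).dualAnnihilator.map (LinearMap.range ρ.dualMap).mkQ
      = Submodule.torsion ℤ (Module.Dual ℤ M ⧸ LinearMap.range ρ.dualMap) := by
  have hA : LinearMap.range ρ.dualMap ≤ (LinearMap.ker ρ).dualAnnihilator := by
    rintro _ ⟨ψ, rfl⟩
    rw [Submodule.mem_dualAnnihilator]
    intro x hx
    rw [LinearMap.dualMap_apply, LinearMap.mem_ker.1 hx, map_zero]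
  have hS : ∀ (k : ℤ), k ≠ 0 → ∀ φ : Module.Dual ℤ M,
      k • φ ∈ (LinearMap.ker ρ).dualAnnihilator → φ ∈ (LinearMap.ker ρ).dualAnnihilator := by
    intro k hk φ h
    rw [Submodule.mem_dualAnnihilator] at h ⊢
    intro x hx
    have := h x hx
    rw [LinearMap.smul_apply, smul_eq_mul] at this
    exact (mul_eq_zero.1 this).resolve_left hk
  have hE : ∀ φ ∈ (LinearMap.ker ρ).dualAnnihilator,
      ∃ k : ℤ, k ≠ 0 ∧ k • φ ∈ LinearMap.range ρ.dualMap := by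
    intro φ h
    rw [Submodule.mem_dualAnnihilator] at h
    obtain ⟨k, hk, ψ, hψ⟩ := aux_ext ρ φ (fun x hx => h x hx)
    exact ⟨k, hk, ψ, LinearMap.ext fun x => by simp [LinearMap.dualMap_apply, hψ]⟩
  refine ⟨hA, fun φ => ⟨fun h => ?_, ?_⟩, ?_, ?_⟩
  · obtain ⟨k, hk, hm⟩ := hE φ h
    refine ⟨k.natAbs, Int.natAbs_pos.2 hk, ?_⟩
    rw [← natCast_zsmul]
    rcases Int.natAbs_eq k with h1 | h1
    · rwa [← h1]
    · have : ((k.natAbs : ℕ) : ℤ) = -k := by omega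
      rw [this, neg_smul]
      exact neg_mem hm
  · rintro ⟨k, hk, hm⟩
    rw [← natCast_zsmul] at hm
    exact hS k (by omega) φ (hA hm)
  · intro x
    obtain ⟨φ, rfl⟩ := Submodule.mkQ_surjective _ x
    rintro ⟨k, hk, hm⟩
    rw [← map_nsmul, Submodule.mkQ_apply, Submodule.Quotient.mk_eq_zero, ← natCast_zsmul] at hm
    rw [Submodule.mkQ_apply, Submodule.Quotient.mk_eq_zero]
    exact hS k (by omega) φ hm
  · ext x
    obtain ⟨φ, rfl⟩ := Submodule.mkQ_surjective _ x
    rw [Submodule.mem_torsion_iff]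
    constructor
    · rintro ⟨φ', h', he⟩
      rw [← he]
      obtain ⟨k, hk, hm⟩ := hE φ' h'
      refine ⟨⟨k, mem_nonZeroDivisors_of_ne_zero hk⟩, ?_⟩
      change k • (LinearMap.range ρ.dualMap).mkQ φ' = 0
      rw [← map_smul, Submodule.mkQ_apply, Submodule.Quotient.mk_eq_zero]
      exact hm
    · rintro ⟨⟨k, hk⟩, hm⟩
      change k • (LinearMap.range ρ.dualMap).mkQ φ = 0 at hm
      rw [← map_smul, Submodule.mkQ_apply, Submodule.Quotient.mk_eq_zero] at hm
      exact ⟨φ, hS k (nonZeroDivisors.ne_zero hk) φ (hA hm), rfl⟩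
end
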